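/- Let m ≥ 1 and N = 2m, let a_1,…,a_k be complex numbers, let g(z) = ∏_{i=1}^k (1 − a_i z), and let φ(e^{iθ}) = g(e^{iθ})·g(e^{−iθ}) with Fourier coefficients φ_n = (1/2π)∫_0^{2π} φ(e^{iθ}) e^{−inθ} dθ. Then the average over O^+(N+1) = SO(N+1) of ∏_{i=1}^k det(I − a_i u) equals g(1) · det[(φ_{j−k} − φ_{j+k+1})_{0≤j,k≤m−1}], where g(1) = ∏_{i=1}^k (1 − a_i). -/

import Mathlib

open MeasureTheory Matrix

instance matrixMS {m n α : Type*} [MeasurableSpace α] : MeasurableSpace (Matrix m n α) :=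
  inferInstanceAs (MeasurableSpace (m → n → α))

/-- The special orthogonal group `SO(N)` as a subgroup of the real orthogonal group `O(N)`. -/
def SOg (N : ℕ) : Subgroup (Matrix.orthogonalGroup (Fin N) ℝ) where
  carrier := {u | (u : Matrix (Fin N) (Fin N) ℝ).det = 1}
  one_mem' := by simp
  mul_mem' := by
    intro x y hx hy
    simp only [Set.mem_setOf_eq] at *
    rw [Submonoid.coe_mul, Matrix.det_mul, hx, hy, one_mul]
  inv_mem' := by
    intro u hu
    simp only [Set.mem_setOf_eq, SetLike.mem_coe] at *
    have h1 : u⁻¹ * u = 1 := inv_mul_cancel u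
    have h2 : ((u⁻¹ : Matrix.orthogonalGroup (Fin N) ℝ) : Matrix (Fin N) (Fin N) ℝ)
        * (u : Matrix (Fin N) (Fin N) ℝ) = 1 := by
      have := congrArg
        (fun v : Matrix.orthogonalGroup (Fin N) ℝ => (v : Matrix (Fin N) (Fin N) ℝ)) h1
      simpa using this
    have h3 := congrArg Matrix.det h2
    rw [Matrix.det_mul, hu, mul_one] at h3
    simpa using h3

/-- A real orthogonal matrix viewed as a complex matrix. -/
noncomputable def toC {N : ℕ} (u : Matrix.orthogonalGroup (Fin N) ℝ) :
    Matrix (Fin N) (Fin N) ℂ :=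
  ((u : Matrix (Fin N) (Fin N) ℝ)).map (fun x => (x : ℂ))

/-- The symbol `φ(e^{iθ}) = g(e^{iθ}) g(e^{-iθ})` where `g(z) = ∏_i (1 - a_i z)`. -/
noncomputable def phiGG {k : ℕ} (a : Fin k → ℂ) (θ : ℝ) : ℂ :=
  (∏ i, (1 - a i * Complex.exp (Complex.I * θ))) *
    ∏ i, (1 - a i * Complex.exp (-Complex.I * θ))

/-- The `n`-th Fourier coefficient `φ_n = (1/2π) ∫_0^{2π} φ(e^{iθ}) e^{-inθ} dθ`. -/
noncomputable def fCoeff (f : ℝ → ℂ) (n : ℤ) : ℂ :=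
  ((2 * Real.pi : ℝ) : ℂ)⁻¹ *
    ∫ θ in (0 : ℝ)..(2 * Real.pi), f θ * Complex.exp (-(n : ℂ) * Complex.I * θ)

section

open Polynomial

section ChebyshevPolynomials

/-- The monic Chebyshev polynomials of the fourth kind, in the variable `X = z + z⁻¹`. -/
noncomputable def chebW (R : Type*) [CommRing R] : ℕ → R[X]
  | 0 => 1
  | 1 => X + 1
  | n + 2 => X * chebW R (n + 1) - chebW R n

/-- The monic Chebyshev polynomials of the third kind, in the variable `X = z + z⁻¹`. -/
noncomputable def chebV (R : Type*) [CommRing R] : ℕ → R[X]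
  | 0 => 1
  | 1 => X - 1
  | n + 2 => X * chebV R (n + 1) - chebV R n

variable {R : Type*} [CommRing R]

lemma chebW_add_two (n : ℕ) : chebW R (n + 2) = X * chebW R (n + 1) - chebW R n := by rw [chebW]

lemma chebV_add_two (n : ℕ) : chebV R (n + 2) = X * chebV R (n + 1) - chebV R n := by rw [chebV]

lemma map_chebW {S : Type*} [CommRing S] (f : R →+* S) (n : ℕ) :
    (chebW R n).map f = chebW S n := by
  induction n using Nat.twoStepInduction with
  | zero => simp [chebW]
  | one => simp [chebW]
  | more n h₀ h₁ => simp [chebW_add_two, h₀, h₁]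

lemma chebW_monic_natDegree [Nontrivial R] (n : ℕ) :
    (chebW R n).Monic ∧ (chebW R n).natDegree = n := by
  induction n using Nat.twoStepInduction with
  | zero => simp [chebW]
  | one =>
    rw [chebW, ← C_1]
    exact ⟨monic_X_add_C _, natDegree_X_add_C _⟩
  | more n h₀ h₁ =>
    have hm : (X * chebW R (n + 1)).Monic := monic_X.mul h₁.1
    have hd : (X * chebW R (n + 1)).natDegree = n + 2 := by
      rw [monic_X.natDegree_mul h₁.1, h₁.2, natDegree_X]; ring
    have hlt : (chebW R n).degree < (X * chebW R (n + 1)).degree := by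
      rw [degree_eq_natDegree h₀.1.ne_zero, degree_eq_natDegree hm.ne_zero, hd, h₀.2]
      exact_mod_cast (by lia : n < n + 2)
    rw [chebW_add_two]
    exact ⟨hm.sub_of_left hlt,
      (natDegree_eq_of_degree_eq (degree_sub_eq_left_of_degree_lt hlt)).trans hd⟩

lemma chebW_monic [Nontrivial R] (n : ℕ) : (chebW R n).Monic := (chebW_monic_natDegree n).1

lemma natDegree_chebW [Nontrivial R] (n : ℕ) : (chebW R n).natDegree = n :=
  (chebW_monic_natDegree n).2

lemma X_sub_two_mul_chebW_succ (n : ℕ) :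
    ((X - 2) * chebW R (n + 1) = X * chebV R (n + 1) - 2 * chebV R n) ∧
    ((X - 2) * chebW R (n + 2) = X * chebV R (n + 2) - 2 * chebV R (n + 1)) := by
  induction n with
  | zero => constructor <;> simp only [chebW, chebV] <;> ring
  | succ n ih =>
    refine ⟨ih.2, ?_⟩
    rw [chebW_add_two (n + 1), chebV_add_two (n + 1)]
    have := chebV_add_two (R := R) n
    linear_combination X * ih.2 - ih.1 + 2 * this

lemma X_add_two_mul_chebV_succ (n : ℕ) :
    ((X + 2) * chebV R (n + 1) = X * chebW R (n + 1) + -2 * chebW R n) ∧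
    ((X + 2) * chebV R (n + 2) = X * chebW R (n + 2) + -2 * chebW R (n + 1)) := by
  induction n with
  | zero => constructor <;> simp only [chebW, chebV] <;> ring
  | succ n ih =>
    refine ⟨ih.2, ?_⟩
    rw [chebW_add_two (n + 1), chebV_add_two (n + 1)]
    have := chebW_add_two (R := R) n
    linear_combination X * ih.2 - ih.1 + 2 * this

lemma two_mul_X_sub_two_mul_derivative_chebW (n : ℕ) :
    2 * (X - 2) * derivative (chebW R n) = (2 * (n : R[X]) + 1) * chebV R n - chebW R n := by
  induction n using Nat.twoStepInduction with
  | zero => simp [chebW, chebV]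
  | one => simp only [chebW, chebV, derivative_add, derivative_X, derivative_one]; push_cast; ring
  | more n h₀ h₁ =>
    have h := (X_sub_two_mul_chebW_succ (R := R) n).1
    simp only [chebW_add_two, chebV_add_two, derivative_sub, derivative_mul, derivative_X]
    push_cast at *
    linear_combination X * h₁ - h₀ + 2 * h

lemma two_mul_X_add_two_mul_derivative_chebV (n : ℕ) :
    2 * (X + 2) * derivative (chebV R n) = (2 * (n : R[X]) + 1) * chebW R n - chebV R n := by
  induction n using Nat.twoStepInduction with
  | zero => simp [chebW, chebV]
  | one => simp only [chebW, chebV, derivative_sub, derivative_X, derivative_one]; push_cast; ring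
  | more n h₀ h₁ =>
    have h := (X_add_two_mul_chebV_succ (R := R) n).1
    simp only [chebW_add_two, chebV_add_two, derivative_sub, derivative_mul, derivative_X]
    push_cast at *
    linear_combination X * h₁ - h₀ + 2 * h

/-- The second order differential operator diagonalised by the polynomials `chebW`. -/
noncomputable def jacobiOp (f : ℝ[X]) : ℝ[X] :=
  (X ^ 2 - 4) * derivative (derivative f) + (2 * X + 2) * derivative f

lemma jacobiOp_C_mul (c : ℝ) (f : ℝ[X]) : jacobiOp (C c * f) = C c * jacobiOp f := by
  simp only [jacobiOp, derivative_C_mul]; ring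

lemma jacobiOp_sum {ι : Type*} (s : Finset ι) (f : ι → ℝ[X]) :
    jacobiOp (∑ i ∈ s, f i) = ∑ i ∈ s, jacobiOp (f i) := by
  simp only [jacobiOp, derivative_sum, Finset.mul_sum, Finset.sum_add_distrib]

lemma jacobiOp_mul (f g : ℝ[X]) :
    jacobiOp (f * g) = jacobiOp f * g + f * jacobiOp g +
      2 * (X ^ 2 - 4) * (derivative f * derivative g) := by
  simp only [jacobiOp, derivative_mul, derivative_add]; ring

lemma jacobiOp_chebW (n : ℕ) : jacobiOp (chebW ℝ n) = C ((n : ℝ) * (n + 1)) * chebW ℝ n := by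
  have h₁ := two_mul_X_sub_two_mul_derivative_chebW (R := ℝ) n
  have h₂ := two_mul_X_add_two_mul_derivative_chebV (R := ℝ) n
  have h₃ := congrArg derivative h₁
  have e2 : derivative (2 : ℝ[X]) = 0 := by simp
  have en : derivative (n : ℝ[X]) = 0 := derivative_natCast
  simp only [derivative_mul, derivative_sub, derivative_X, derivative_add, derivative_one, e2, en]
    at h₃
  have h4 : (4 : ℝ[X]) ≠ 0 := by
    rw [show (4 : ℝ[X]) = C 4 from rfl]; simp
  apply mul_left_cancel₀ h4
  simp only [jacobiOp, C_mul, C_add, C_1, ← C_eq_natCast] at *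
  linear_combination 2 * (X + 2) * h₃ + (2 * C (n : ℝ) + 1) * h₂ + h₁

lemma one_sub_mul_pow_mul_eval_chebW {K : Type*} [Field K] {z : K} (hz : z ≠ 0) (n : ℕ) :
    (1 - z) * z ^ n * (chebW K n).eval (z + z⁻¹) = 1 - z ^ (2 * n + 1) := by
  induction n using Nat.twoStepInduction with
  | zero => simp [chebW]
  | one => simp [chebW]; field_simp; ring
  | more n h₀ h₁ =>
    have hzz : z * (z + z⁻¹) = z ^ 2 + 1 := by field_simp
    simp only [chebW_add_two, eval_sub, eval_mul, eval_X]
    linear_combination (z ^ 2 + 1) * h₁ - z ^ 2 * h₀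
      + (1 - z) * z ^ (n + 1) * eval (z + z⁻¹) (chebW K (n + 1)) * hzz

/-- The basis of `ℝ[X]` formed by the polynomials `chebW`. -/
noncomputable def chebWBasis : Module.Basis ℕ ℝ ℝ[X] :=
  Polynomial.Sequence.basis
    ⟨chebW ℝ, fun i => by
      rw [degree_eq_natDegree (chebW_monic i).ne_zero, natDegree_chebW]⟩
    fun i => by
      change IsUnit (chebW ℝ i).leadingCoeff
      rw [(chebW_monic i).leadingCoeff]; exact isUnit_one

lemma chebWBasis_apply (n : ℕ) : chebWBasis n = chebW ℝ n :=
  Polynomial.Sequence.basis_eq_self _ _ _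

lemma chebWBasis_repr_chebW (n r : ℕ) :
    chebWBasis.repr (chebW ℝ n) r = if n = r then 1 else 0 := by
  rw [← chebWBasis_apply, Module.Basis.repr_self, Finsupp.single_apply]

lemma chebWBasis_repr_eq_zero {f : ℝ[X]} {r : ℕ} (h : f.degree < r) :
    chebWBasis.repr f r = 0 := by
  induction hN : f.natDegree using Nat.strong_induction_on generalizing f with
  | _ N ih =>
    by_cases hf : f = 0
    · simp [hf]
    have hNr : N < r := by
      rw [degree_eq_natDegree hf, hN] at h
      exact_mod_cast h
    set g := f - C f.leadingCoeff * chebW ℝ N with hg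
    have hgf : f = g + f.leadingCoeff • chebW ℝ N := by
      rw [hg, smul_eq_C_mul]; ring
    have hdeg : g.degree < f.degree := by
      have hlc : f.leadingCoeff ≠ 0 := leadingCoeff_ne_zero.mpr hf
      apply degree_sub_lt_left
      · rw [degree_C_mul hlc, degree_eq_natDegree hf, degree_eq_natDegree (chebW_monic N).ne_zero,
          natDegree_chebW, hN]
      · exact hf
      · rw [leadingCoeff_mul, leadingCoeff_C, (chebW_monic N).leadingCoeff, mul_one]
    have hg0 : chebWBasis.repr g r = 0 := by
      by_cases hg' : g = 0
      · simp [hg']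
      · exact ih _ (hN ▸ natDegree_lt_natDegree hg' hdeg) (hdeg.trans h) rfl
    rw [hgf, map_add, map_smul, Finsupp.add_apply, Finsupp.smul_apply, hg0,
      chebWBasis_repr_chebW, if_neg hNr.ne, smul_zero, zero_add]

lemma chebWBasis_repr_monic {f : ℝ[X]} (h : f.Monic) : chebWBasis.repr f f.natDegree = 1 := by
  have hdeg : (f - chebW ℝ f.natDegree).degree < f.natDegree := by
    rw [← degree_eq_natDegree h.ne_zero]
    apply degree_sub_lt_left _ h.ne_zero
    · rw [h.leadingCoeff, (chebW_monic _).leadingCoeff]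
    · rw [degree_eq_natDegree h.ne_zero, degree_eq_natDegree (chebW_monic _).ne_zero,
        natDegree_chebW]
  have h0 := chebWBasis_repr_eq_zero hdeg
  rw [map_sub, Finsupp.sub_apply, chebWBasis_repr_chebW, if_pos rfl] at h0
  linarith

lemma eq_sum_chebWBasis_repr {f : ℝ[X]} {n : ℕ} (h : f.degree < n) :
    f = ∑ r : Fin n, C (chebWBasis.repr f r) * chebW ℝ r := by
  conv_lhs => rw [← chebWBasis.linearCombination_repr f]
  rw [Finsupp.linearCombination_apply, Finsupp.sum_of_support_subset (s := Finset.range n),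
    Finset.sum_range]
  · simp only [chebWBasis_apply, smul_eq_C_mul]
  · intro r hr
    by_contra hr'
    simp only [Finset.mem_range, not_lt] at hr'
    exact (Finsupp.mem_support_iff.mp hr)
      (chebWBasis_repr_eq_zero (h.trans_le (by exact_mod_cast hr')))
  · simp

end ChebyshevPolynomials

section AlternatingExpansion

lemma det_sum_mul_eq_sum_prod_mul_det {R : Type*} [CommRing R] {k n : ℕ}
    (w : Fin k → Fin n → R) (Q : Fin n → Fin k → R) :
    (Matrix.of fun i s => ∑ r, w i r * Q r s).det =
      ∑ r : Fin k → Fin n, (∏ i, w i (r i)) * (Matrix.of fun i s => Q (r i) s).det := by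
  have h₁ : (Matrix.of fun i s => ∑ r, w i r * Q r s).det =
      Matrix.detRowAlternating.toMultilinearMap (fun i => ∑ r, w i r • Q r) := by
    change Matrix.det _ = Matrix.det _
    congr 1
    ext i s
    simp
  rw [h₁, MultilinearMap.map_sum]
  refine Finset.sum_congr rfl fun r _ => ?_
  rw [MultilinearMap.map_smul_univ, smul_eq_mul]
  rfl

lemma sum_det_updateRow_mul {R : Type*} [CommRing R] {k : ℕ} (M : Matrix (Fin k) (Fin k) R)
    (d : Fin k → R) :
    ∑ i, (M.updateRow i fun s => d s * M i s).det = (∑ s, d s) * M.det := by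
  have h : ∀ i, (M.updateRow i fun s => d s * M i s).det =
      ∑ s, d s * M i s * M.adjugate s i := by
    intro i
    rw [← Matrix.det_transpose, ← Matrix.updateCol_transpose, ← Matrix.cramer_apply,
      Matrix.cramer_eq_adjugate_mulVec, ← Matrix.adjugate_transpose, Matrix.mulVec, dotProduct]
    exact Finset.sum_congr rfl fun s _ => by rw [Matrix.transpose_apply]; ring
  simp_rw [h]
  rw [Finset.sum_comm, Finset.sum_mul]
  refine Finset.sum_congr rfl fun s _ => ?_
  have := congrFun (congrFun (Matrix.adjugate_mul M) s) s
  rw [Matrix.mul_apply, Matrix.smul_apply, Matrix.one_apply_eq, smul_eq_mul, mul_one] at this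
  rw [← this, Finset.mul_sum]
  exact Finset.sum_congr rfl fun i _ => by ring

lemma det_updateRow_mul_rows {R : Type*} [CommRing R] {k : ℕ} (P : Matrix (Fin k) (Fin k) R)
    (x : Fin k → R) (i : Fin k) (c : R) (v : Fin k → R) :
    ((Matrix.of fun l s => x l * P l s).updateRow i fun s => c * v s).det =
      c * (∏ l ∈ Finset.univ.erase i, x l) * (P.updateRow i v).det := by
  have h : ((Matrix.of fun l s => x l * P l s).updateRow i fun s => c * v s) =
      Matrix.of fun l s => Function.update x i c l * P.updateRow i v l s := by
    ext l s
    by_cases hl : l = i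
    · subst hl; simp
    · simp [hl]
  rw [h, Matrix.det_mul_column, ← Finset.mul_prod_erase _ _ (Finset.mem_univ i),
    Function.update_self]
  congr 2
  exact Finset.prod_congr rfl fun l hl => Function.update_of_ne (Finset.ne_of_mem_erase hl) _ _

/-- The matrix of values of the polynomials `chebW` of degree less than `k`. -/
noncomputable def chebWMatrix {R : Type*} [CommRing R] {k : ℕ} (A : Fin k → R) :
    Matrix (Fin k) (Fin k) R :=
  Matrix.of fun i s => (chebW R s).eval (A i)

lemma det_chebWMatrix {R : Type*} [CommRing R] [Nontrivial R] {k : ℕ} (A : Fin k → R) :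
    (chebWMatrix A).det = (Matrix.vandermonde A).det :=
  (Matrix.det_eval_matrixOfPolynomials_eq_det_vandermonde A (fun s : Fin k => chebW R s)
    (fun _ => natDegree_chebW _) (fun _ => chebW_monic _)).symm

lemma det_updateRow_derivative_chebW {k : ℕ} {A : Fin k → ℝ} (hA : Function.Injective A)
    (i : Fin k) :
    ((chebWMatrix A).updateRow i fun s => (derivative (chebW ℝ s)).eval (A i)).det =
      (chebWMatrix A).det * ∑ l ∈ Finset.univ.erase i, (A i - A l)⁻¹ := by
  set P := chebWMatrix A with hP
  have hdet : ∀ v : Fin k → ℝ, (P.updateRow i v).det = ∑ s, P.adjugate s i * v s := by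
    intro v
    rw [← Matrix.det_transpose, ← Matrix.updateCol_transpose, ← Matrix.cramer_apply,
      Matrix.cramer_eq_adjugate_mulVec, ← Matrix.adjugate_transpose, Matrix.mulVec, dotProduct]
    rfl
  set f : ℝ[X] := ∑ s : Fin k, C (P.adjugate s i) * chebW ℝ s with hf
  set g : ℝ[X] := ∏ l ∈ Finset.univ.erase i, (X - C (A l)) with hg
  have hfx : ∀ x, f.eval x = (P.updateRow i fun s => (chebW ℝ s).eval x).det := by
    intro x; rw [hdet, hf, eval_finsetSum]; simp
  have hfi : f.eval (A i) = P.det := by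
    rw [hfx]; congr 1; ext l s
    by_cases hl : l = i
    · subst hl; simp [hP, chebWMatrix]
    · simp [hl]
  have hgi : g.eval (A i) ≠ 0 := by
    rw [hg, eval_prod]
    refine Finset.prod_ne_zero_iff.mpr fun l hl => ?_
    rw [eval_sub, eval_X, eval_C, sub_ne_zero]
    exact fun h => Finset.ne_of_mem_erase hl (hA h).symm
  have hk : 0 < k := Fin.pos i
  have hfg : f = C (P.det / g.eval (A i)) * g := by
    apply Polynomial.eq_of_degrees_lt_of_eval_index_eq (s := Finset.univ) (v := A)
      hA.injOn
    · rw [Finset.card_univ, Fintype.card_fin]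
      refine (degree_sum_le _ _).trans_lt ((Finset.sup_lt_iff (by simp)).mpr fun s _ => ?_)
      refine (degree_mul_le _ _).trans_lt ?_
      rw [degree_eq_natDegree (chebW_monic (R := ℝ) s).ne_zero, natDegree_chebW]
      refine (add_le_add_left degree_C_le _).trans_lt ?_
      rw [zero_add]
      exact_mod_cast s.2
    · rw [Finset.card_univ, Fintype.card_fin]
      refine (degree_mul_le _ _).trans_lt ((add_le_add_left degree_C_le _).trans_lt ?_)
      rw [zero_add, hg, degree_prod]
      simp only [degree_X_sub_C, Finset.sum_const, Finset.card_erase_of_mem (Finset.mem_univ i),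
        Finset.card_univ, Fintype.card_fin, nsmul_eq_mul, mul_one]
      exact_mod_cast Nat.sub_lt hk one_pos
    · intro l _
      by_cases hl : l = i
      · subst hl
        rw [hfi, eval_mul, eval_C, div_mul_cancel₀ _ hgi]
      · have h0 : g.eval (A l) = 0 := by
          rw [hg, eval_prod]
          exact Finset.prod_eq_zero (Finset.mem_erase.mpr ⟨hl, Finset.mem_univ l⟩) (by simp)
        rw [eval_mul, h0, mul_zero, hfx]
        refine Matrix.det_zero_of_row_eq (i := i) (j := l) (Ne.symm hl) ?_
        ext s
        simp [hl, hP, chebWMatrix]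
  have hder : (derivative g).eval (A i) =
      g.eval (A i) * ∑ l ∈ Finset.univ.erase i, (A i - A l)⁻¹ := by
    rw [hg, derivative_prod_finset, eval_finsetSum, Finset.mul_sum]
    refine Finset.sum_congr rfl fun l hl => ?_
    have hne : A i - A l ≠ 0 :=
      sub_ne_zero.mpr fun h => Finset.ne_of_mem_erase hl (hA h).symm
    rw [derivative_X_sub_C, mul_one, ← Finset.mul_prod_erase _ _ hl, eval_mul, eval_sub, eval_X,
      eval_C]
    field_simp
  have hder' : (derivative f).eval (A i) =
      ((P.updateRow i fun s => (derivative (chebW ℝ s)).eval (A i))).det := by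
    rw [hdet, hf, derivative_sum, eval_finsetSum]; simp
  rw [← hder', hfg, derivative_C_mul, eval_mul, eval_C, hder]
  field_simp

/-- The coordinate of `chebW 0 * χ ∧ ⋯ ∧ chebW (k - 1) * χ` at the multi-index `r`. -/
noncomputable def wedgeCoord {k n : ℕ} (χ : ℝ[X]) (r : Fin k → Fin n) : ℝ :=
  (Matrix.of fun i s : Fin k => chebWBasis.repr (chebW ℝ s * χ) (r i)).det

lemma degree_chebW_mul_lt {m k : ℕ} {χ : ℝ[X]} (hm : χ.natDegree = m) (hχ : χ.Monic) (s : Fin k) :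
    (chebW ℝ s * χ).degree < (m + k : ℕ) := by
  rw [degree_eq_natDegree ((chebW_monic _).mul hχ).ne_zero, (chebW_monic _).natDegree_mul hχ,
    natDegree_chebW, hm]
  exact_mod_cast (by lia : (s : ℕ) + m < m + k)

lemma sum_prod_eval_mul_wedgeCoord {S : Type*} [CommRing S] [Algebra ℝ S] {m k : ℕ} {χ : ℝ[X]}
    (hm : χ.natDegree = m) (hχ : χ.Monic) (A : Fin k → S) :
    ∑ r : Fin k → Fin (m + k),
        (∏ i, (chebW S (r i)).eval (A i)) * algebraMap ℝ S (wedgeCoord χ r) =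
      (∏ i, aeval (A i) χ) * (chebWMatrix A).det := by
  have h : ∀ (i s : Fin k), aeval (A i) χ * chebWMatrix A i s =
      ∑ r : Fin (m + k), (chebW S r).eval (A i) *
        algebraMap ℝ S (chebWBasis.repr (chebW ℝ s * χ) r) := by
    intro i s
    have h1 := congrArg (aeval (A i)) (eq_sum_chebWBasis_repr (degree_chebW_mul_lt hm hχ s))
    have h2 : ∀ t : ℕ, aeval (A i) (chebW ℝ t) = (chebW S t).eval (A i) := by
      intro t
      rw [← map_chebW (algebraMap ℝ S), eval_map_algebraMap]
    rw [map_mul, map_sum, h2] at h1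
    rw [chebWMatrix, Matrix.of_apply, mul_comm, h1]
    refine Finset.sum_congr rfl fun r _ => ?_
    rw [map_mul, h2, aeval_C, mul_comm]
  rw [← Matrix.det_mul_column]
  simp_rw [h]
  rw [det_sum_mul_eq_sum_prod_mul_det]
  refine Finset.sum_congr rfl fun r _ => ?_
  rw [wedgeCoord, RingHom.map_det]
  rfl

lemma sum_eigenvalue_mul_wedgeCoord {m k : ℕ} {χ : ℝ[X]}
    (hm : χ.natDegree = m) (hχ : χ.Monic) {A : Fin k → ℝ} (hA : Function.Injective A)
    (hχA : ∀ i, χ.eval (A i) ≠ 0) :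
    ∑ r : Fin k → Fin (m + k), (∑ i, ((r i : ℕ) : ℝ) * ((r i : ℕ) + 1)) *
        ((∏ i, (chebW ℝ (r i)).eval (A i)) * wedgeCoord χ r) =
      (∏ i, χ.eval (A i)) * (chebWMatrix A).det *
        ((∑ s : Fin k, (s : ℝ) * (s + 1)) + ∑ i, (jacobiOp χ).eval (A i) / χ.eval (A i) +
          ∑ i, ∑ l ∈ Finset.univ.erase i, 2 * ((A i ^ 2 - 4) *
            ((derivative χ).eval (A i) / χ.eval (A i)) * (A i - A l)⁻¹)) := by
  set P := chebWMatrix A with hP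
  set M : Matrix (Fin k) (Fin k) ℝ := Matrix.of fun i s => χ.eval (A i) * P i s with hM
  have hMdet : M.det = (∏ i, χ.eval (A i)) * P.det := Matrix.det_mul_column _ _
  have hprod : ∀ i, ∏ l ∈ Finset.univ.erase i, χ.eval (A l) =
      (∏ l, χ.eval (A l)) / χ.eval (A i) := by
    intro i
    rw [← Finset.mul_prod_erase _ _ (Finset.mem_univ i), mul_div_cancel_left₀ _ (hχA i)]
  have hrow : ∀ i s : Fin k, ∑ r : Fin (m + k), ((r : ℝ) * (r + 1) * (chebW ℝ r).eval (A i)) *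
      chebWBasis.repr (chebW ℝ s * χ) r = (jacobiOp (chebW ℝ s * χ)).eval (A i) := by
    intro i s
    conv_rhs => rw [eq_sum_chebWBasis_repr (degree_chebW_mul_lt hm hχ s), jacobiOp_sum,
      eval_finsetSum]
    refine Finset.sum_congr rfl fun r _ => ?_
    rw [jacobiOp_C_mul, jacobiOp_chebW]
    simp only [eval_mul, eval_C]
    ring
  have hrow' : ∀ i s : Fin k, ∑ r : Fin (m + k), (chebW ℝ r).eval (A i) *
      chebWBasis.repr (chebW ℝ s * χ) r = M i s := by
    intro i s
    have h1 := congrArg (eval (A i)) (eq_sum_chebWBasis_repr (degree_chebW_mul_lt hm hχ s))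
    rw [eval_mul, eval_finsetSum] at h1
    rw [hM, Matrix.of_apply, hP, chebWMatrix, Matrix.of_apply, mul_comm (χ.eval _), h1]
    refine Finset.sum_congr rfl fun r _ => ?_
    rw [eval_mul, eval_C, mul_comm]
  have hexp : ∀ i, (M.updateRow i fun s => (jacobiOp (chebW ℝ s * χ)).eval (A i)).det =
      ∑ r : Fin k → Fin (m + k), (((r i : ℕ) : ℝ) * ((r i : ℕ) + 1)) *
        ((∏ i, (chebW ℝ (r i)).eval (A i)) * wedgeCoord χ r) := by
    intro i
    have := det_sum_mul_eq_sum_prod_mul_det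
      (fun (l : Fin k) (r : Fin (m + k)) => (if l = i then (r : ℝ) * (r + 1) else 1) *
        (chebW ℝ r).eval (A l)) (fun r s => chebWBasis.repr (chebW ℝ s * χ) r)
    rw [show (M.updateRow i fun s => (jacobiOp (chebW ℝ s * χ)).eval (A i)) = _ from ?_, this]
    · refine Finset.sum_congr rfl fun r _ => ?_
      rw [Finset.prod_mul_distrib, Finset.prod_ite_eq' Finset.univ i, if_pos (Finset.mem_univ i),
        mul_assoc]
      rfl
    · ext l s
      by_cases hl : l = i
      · subst hl
        simp [← hrow]
      · simp [hl, ← hrow']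
  have hsplit : ∀ i, (M.updateRow i fun s => (jacobiOp (chebW ℝ s * χ)).eval (A i)).det =
      (M.updateRow i fun s => ((s : ℝ) * (s + 1)) * M i s).det +
      (∏ i, χ.eval (A i)) * P.det * ((jacobiOp χ).eval (A i) / χ.eval (A i)) +
      (∏ i, χ.eval (A i)) * P.det * ∑ l ∈ Finset.univ.erase i, 2 * ((A i ^ 2 - 4) *
            ((derivative χ).eval (A i) / χ.eval (A i)) * (A i - A l)⁻¹) := by
    intro i
    have e : (fun s : Fin k => (jacobiOp (chebW ℝ s * χ)).eval (A i)) =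
        ((fun s : Fin k => ((s : ℝ) * (s + 1)) * M i s) +
        (fun s : Fin k => (jacobiOp χ).eval (A i) * P i s)) +
        (fun s : Fin k => (2 * (A i ^ 2 - 4) * (derivative χ).eval (A i)) *
          (derivative (chebW ℝ s)).eval (A i)) := by
      ext s
      rw [jacobiOp_mul, jacobiOp_chebW]
      simp only [eval_add, eval_mul, eval_C, eval_sub, eval_pow, eval_X, eval_ofNat, Pi.add_apply,
        hM, Matrix.of_apply, hP, chebWMatrix]
      ring
    rw [e, Matrix.det_updateRow_add, Matrix.det_updateRow_add]
    congr 1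
    · congr 1
      rw [hM, det_updateRow_mul_rows, Matrix.updateRow_eq_self, hprod]
      ring
    · rw [hM, det_updateRow_mul_rows, det_updateRow_derivative_chebW hA, hprod, Finset.mul_sum,
        Finset.mul_sum, Finset.mul_sum]
      exact Finset.sum_congr rfl fun l _ => by ring
  have htot := Finset.sum_congr (rfl : (Finset.univ : Finset (Fin k)) = Finset.univ)
    (fun i _ => (hexp i).symm.trans (hsplit i))
  rw [Finset.sum_comm, Finset.sum_add_distrib, Finset.sum_add_distrib, sum_det_updateRow_mul,
    ← Finset.mul_sum, ← Finset.mul_sum, hMdet] at htot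
  simp_rw [← Finset.sum_mul] at htot
  rw [htot]
  ring

end AlternatingExpansion

section TopCoordinate

lemma sum_sum_erase_comm {ι R : Type*} [Fintype ι] [DecidableEq ι] [AddCommMonoid R]
    (f : ι → ι → R) :
    ∑ i, ∑ l ∈ Finset.univ.erase i, f i l = ∑ i, ∑ l ∈ Finset.univ.erase i, f l i := by
  refine Finset.sum_comm' fun i l => ?_
  simp [eq_comm]

lemma sum_shifted_eigenvalue (m k : ℕ) :
    ∑ s : Fin k, ((m : ℝ) + s) * (m + s + 1) =
      ∑ s : Fin k, (s : ℝ) * (s + 1) + k * (m * (m + 1)) + k * (k - 1) * m := by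
  have hs : ∑ s : Fin k, (s : ℝ) * 2 = k * (k - 1) := by
    rw [Fin.sum_univ_eq_sum_range (fun s => (s : ℝ) * 2)]
    induction k with
    | zero => simp
    | succ k ih => rw [Finset.sum_range_succ, ih]; push_cast; ring
  have : ∀ s : Fin k, ((m : ℝ) + s) * (m + s + 1) =
      (s : ℝ) * (s + 1) + m * (m + 1) + (s : ℝ) * 2 * m := fun s => by ring
  simp_rw [this]
  rw [Finset.sum_add_distrib, Finset.sum_add_distrib, ← Finset.sum_mul Finset.univ _ (m : ℝ), hs]
  simp

lemma sum_eigenvalue_sub_mul_wedgeCoord {m k : ℕ} {χ : ℝ[X]}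
    (hm : χ.natDegree = m) (hχ : χ.Monic) {A : Fin k → ℝ} (hA : Function.Injective A)
    (hχA : ∀ i, χ.eval (A i) ≠ 0) :
    ∑ r : Fin k → Fin (m + k), (∑ i, ((r i : ℕ) : ℝ) * ((r i : ℕ) + 1) -
          ∑ s : Fin k, ((m : ℝ) + s) * (m + s + 1)) *
        ((∏ i, (chebW ℝ (r i)).eval (A i)) * wedgeCoord χ r) =
      (∏ i, χ.eval (A i)) * (chebWMatrix A).det *
        (∑ i, ((jacobiOp χ).eval (A i) / χ.eval (A i) - m * (m + 1)) +
          ∑ i, ∑ l ∈ Finset.univ.erase i,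
            (((A i ^ 2 - 4) * ((derivative χ).eval (A i) / χ.eval (A i)) -
              (A l ^ 2 - 4) * ((derivative χ).eval (A l) / χ.eval (A l))) / (A i - A l) - m)) := by
  have h₁ := sum_eigenvalue_mul_wedgeCoord hm hχ hA hχA
  have h₂ := sum_prod_eval_mul_wedgeCoord hm hχ A
  simp only [Algebra.algebraMap_self, RingHom.id_apply, coe_aeval_eq_eval] at h₂
  rw [Finset.sum_congr rfl fun r _ => sub_mul _ _ _, Finset.sum_sub_distrib,
    ← Finset.mul_sum, h₁, h₂, sum_shifted_eigenvalue]
  set α : Fin k → ℝ := fun i => (A i ^ 2 - 4) * ((derivative χ).eval (A i) / χ.eval (A i))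
    with hα
  have h₃ : ∑ i, ∑ l ∈ Finset.univ.erase i, ((α i - α l) / (A i - A l) - m) =
      ∑ i, ∑ l ∈ Finset.univ.erase i, 2 * (α i * (A i - A l)⁻¹) - k * (k - 1) * m := by
    have e₁ : ∑ i, ∑ l ∈ Finset.univ.erase i, ((α i - α l) / (A i - A l) - m) =
        ∑ i, ∑ l ∈ Finset.univ.erase i, α i * (A i - A l)⁻¹ +
        ∑ i, ∑ l ∈ Finset.univ.erase i, α l * (A l - A i)⁻¹ -
        ∑ i : Fin k, ∑ l ∈ Finset.univ.erase i, (m : ℝ) := by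
      simp only [← Finset.sum_add_distrib, ← Finset.sum_sub_distrib]
      refine Finset.sum_congr rfl fun i _ => Finset.sum_congr rfl fun l _ => ?_
      rw [← neg_sub (A i) (A l), inv_neg, div_eq_mul_inv]
      ring
    rw [e₁, ← sum_sum_erase_comm fun i l => α i * (A i - A l)⁻¹, ← two_mul, Finset.mul_sum]
    simp_rw [Finset.mul_sum]
    congr 1
    rcases Nat.eq_zero_or_pos k with rfl | hk
    · simp
    · simp [Finset.card_erase_of_mem, Nat.cast_sub (show 1 ≤ k from hk)]
      ring
  rw [show ∑ i, ∑ l ∈ Finset.univ.erase i,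
            (((A i ^ 2 - 4) * ((derivative χ).eval (A i) / χ.eval (A i)) -
              (A l ^ 2 - 4) * ((derivative χ).eval (A l) / χ.eval (A l))) / (A i - A l) - m) = _
    from h₃, Finset.sum_sub_distrib]
  simp only [hα, Finset.sum_const, Finset.card_univ, Fintype.card_fin, nsmul_eq_mul]
  ring

/-- The coordinate of `chebW m ∧ ⋯ ∧ chebW (m + k - 1)` at the multi-index `r`. -/
noncomputable def topCoord {m k : ℕ} (r : Fin k → Fin (m + k)) : ℝ :=
  (Matrix.of fun i s : Fin k => if (r i : ℕ) = m + s then (1 : ℝ) else 0).det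

lemma topCoord_eq_zero {m k : ℕ} {r : Fin k → Fin (m + k)} {i : Fin k} (h : (r i : ℕ) < m) :
    topCoord r = 0 :=
  Matrix.det_eq_zero_of_row_eq_zero i fun s => by
    rw [Matrix.of_apply, if_neg (by lia)]

lemma wedgeCoord_eq_zero_of_not_injective {k n : ℕ} (χ : ℝ[X]) {r : Fin k → Fin n}
    (h : ¬ Function.Injective r) : wedgeCoord χ r = 0 := by
  obtain ⟨i, j, hij, hne⟩ : ∃ i j, r i = r j ∧ i ≠ j := by
    simpa [Function.Injective] using h
  exact Matrix.det_zero_of_row_eq hne (by ext s; simp [hij])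

lemma wedgeCoord_eq_topCoord {m k : ℕ} {χ : ℝ[X]} (hm : χ.natDegree = m) (hχ : χ.Monic)
    {r : Fin k → Fin (m + k)} (h : ∀ i, m ≤ r i) : wedgeCoord χ r = topCoord r := by
  set T : Matrix (Fin k) (Fin k) ℝ :=
    Matrix.of fun t s => chebWBasis.repr (chebW ℝ s * χ) (m + t) with hT
  have hdeg : ∀ s : ℕ, (chebW ℝ s * χ).natDegree = m + s := fun s => by
    rw [(chebW_monic _).natDegree_mul hχ, natDegree_chebW, hm, add_comm]
  have hTdet : T.det = 1 := by
    rw [Matrix.det_of_isUpperTriangular]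
    · refine Finset.prod_eq_one fun s _ => ?_
      rw [hT, Matrix.of_apply, ← hdeg, chebWBasis_repr_monic ((chebW_monic _).mul hχ)]
    · intro t s hst
      rw [hT, Matrix.of_apply]
      refine chebWBasis_repr_eq_zero ?_
      rw [degree_eq_natDegree ((chebW_monic _).mul hχ).ne_zero, hdeg]
      exact_mod_cast Nat.add_lt_add_left hst m
  have hmul : topCoord r * T.det = wedgeCoord χ r := ?_
  · rw [← hmul, hTdet, mul_one]
  rw [topCoord, wedgeCoord, ← Matrix.det_mul]
  congr 1
  ext i s
  have hi : (r i : ℕ) - m < k := by have := (r i).2; have := h i; lia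
  rw [Matrix.mul_apply, Finset.sum_eq_single ⟨(r i : ℕ) - m, hi⟩]
  · simp [hT, Nat.add_sub_cancel' (h i)]
  · intro t _ ht
    rw [Matrix.of_apply, if_neg, zero_mul]
    intro he
    exact ht (Fin.ext (by simp [he]))
  · simp

lemma sum_eigenvalue_lt {m k : ℕ} {r : Fin k → Fin (m + k)} (hr : Function.Injective r)
    {i : Fin k} (hi : (r i : ℕ) < m) :
    ∑ i, ((r i : ℕ) : ℝ) * ((r i : ℕ) + 1) < ∑ s : Fin k, ((m : ℝ) + s) * (m + s + 1) := by
  set f : ℕ → ℝ := fun x => (x : ℝ) * (x + 1) with hf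
  have hmono : StrictMono f := by
    intro x y hxy
    have : (x : ℝ) < y := by exact_mod_cast hxy
    have hx : (0 : ℝ) ≤ x := x.cast_nonneg
    simp only [hf]
    nlinarith
  have hr' : Function.Injective fun i => (r i : ℕ) := Fin.val_injective.comp hr
  set S := Finset.univ.image fun i => (r i : ℕ) with hS
  set T := Finset.univ.image fun s : Fin k => m + (s : ℕ) with hT
  have hTi : Function.Injective fun s : Fin k => m + (s : ℕ) := fun s t h => Fin.ext (by
    simpa using h)
  have h₁ : ∑ i, ((r i : ℕ) : ℝ) * ((r i : ℕ) + 1) = ∑ x ∈ S, f x := by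
    rw [hS, Finset.sum_image hr'.injOn]
  have h₂ : ∑ s : Fin k, ((m : ℝ) + s) * (m + s + 1) = ∑ x ∈ T, f x := by
    rw [hT, Finset.sum_image hTi.injOn]
    simp [hf]
  have hcard : S.card = T.card := by
    rw [hS, hT, Finset.card_image_of_injective _ hr', Finset.card_image_of_injective _ hTi]
  have hTmem : ∀ x, x ∈ T ↔ m ≤ x ∧ x < m + k := by
    intro x
    simp only [hT, Finset.mem_image, Finset.mem_univ, true_and]
    constructor
    · rintro ⟨s, rfl⟩; have := s.2; lia
    · rintro ⟨h1, h2⟩; exact ⟨⟨x - m, by lia⟩, by simp; lia⟩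
  have hSlt : ∀ x ∈ S, x < m + k := by
    intro x hx
    obtain ⟨i, -, rfl⟩ := Finset.mem_image.mp hx
    exact (r i).2
  rw [h₁, h₂, ← Finset.sum_inter_add_sum_sdiff S T, ← Finset.sum_inter_add_sum_sdiff T S,
    Finset.inter_comm T S]
  gcongr _ + ?_
  calc ∑ x ∈ S \ T, f x < ∑ x ∈ S \ T, f m := by
        refine Finset.sum_lt_sum_of_nonempty ⟨(r i : ℕ), ?_⟩ fun x hx => ?_
        · rw [Finset.mem_sdiff, hTmem]
          exact ⟨Finset.mem_image_of_mem _ (Finset.mem_univ i), by lia⟩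
        · rw [Finset.mem_sdiff, hTmem] at hx
          have := hSlt x hx.1
          exact hmono (by lia)
    _ = ∑ x ∈ T \ S, f m := by
        rw [Finset.sum_const, Finset.sum_const, Finset.card_sdiff_comm hcard]
    _ ≤ ∑ x ∈ T \ S, f x := Finset.sum_le_sum fun x hx => by
        rw [Finset.mem_sdiff, hTmem] at hx
        exact hmono.monotone hx.1.1

lemma sum_prod_eval_mul_topCoord {S : Type*} [CommRing S] [Algebra ℝ S] {m k : ℕ}
    (A : Fin k → S) :
    ∑ r : Fin k → Fin (m + k),
        (∏ i, (chebW S (r i)).eval (A i)) * algebraMap ℝ S (topCoord r) =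
      (Matrix.of fun i s : Fin k => (chebW S (m + s)).eval (A i)).det := by
  have h : (Matrix.of fun i s : Fin k => (chebW S (m + s)).eval (A i)) =
      Matrix.of fun i s : Fin k => ∑ r : Fin (m + k), (chebW S r).eval (A i) *
        algebraMap ℝ S (if (r : ℕ) = m + s then 1 else 0) := by
    ext i s
    rw [Matrix.of_apply, Matrix.of_apply,
      Finset.sum_eq_single (Fin.natAdd m s)]
    · simp
    · intro r _ hr
      rw [if_neg, map_zero, mul_zero]
      exact fun he => hr (Fin.ext (by simpa using he))
    · simp
  rw [h, det_sum_mul_eq_sum_prod_mul_det]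
  refine Finset.sum_congr rfl fun r _ => ?_
  rw [topCoord, RingHom.map_det]
  rfl

lemma add_inv_injOn : Set.InjOn (fun a : ℝ => a + a⁻¹) (Set.Ioo 0 1) := by
  intro a ha b hb hab
  have ha0 := ha.1.ne'
  have hb0 := hb.1.ne'
  have h : (a - b) * (a * b - 1) = 0 := by
    simp only at hab
    field_simp at hab
    linear_combination hab
  rcases mul_eq_zero.mp h with h | h
  · exact sub_eq_zero.mp h
  · nlinarith [ha.1, ha.2, hb.1, hb.2]

lemma eq_zero_of_sum_mul_prod_eval_eq_zero {k n : ℕ} {x : (Fin k → Fin n) → ℝ}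
    (hx : ∀ a : Fin k → ℝ, Function.Injective a → (∀ i, a i ∈ Set.Ioo (0 : ℝ) 1) →
      ∑ r, x r * ∏ i, (chebW ℝ (r i)).eval (a i + (a i)⁻¹) = 0) (s : Fin k → Fin n) :
    x s = 0 := by
  set b : Fin k → Fin n → ℝ := fun i j => ((finProdFinEquiv (i, j) : ℕ) + 2 : ℝ)⁻¹ with hb
  have hbmem : ∀ i j, b i j ∈ Set.Ioo (0 : ℝ) 1 := by
    intro i j
    have : (0 : ℝ) ≤ (finProdFinEquiv (i, j) : ℕ) := Nat.cast_nonneg _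
    exact ⟨by positivity, inv_lt_one_of_one_lt₀ (by linarith)⟩
  have hbinj : ∀ i j i' j', b i j = b i' j' → i = i' ∧ j = j' := by
    intro i j i' j' h
    have h1 : ((finProdFinEquiv (i, j) : ℕ) : ℝ) = (finProdFinEquiv (i', j') : ℕ) := by
      simpa [hb] using h
    have h2 := finProdFinEquiv.injective (Fin.ext (Nat.cast_injective h1))
    exact Prod.mk.injEq _ _ _ _ ▸ h2
  set M : Fin k → Matrix (Fin n) (Fin n) ℝ := fun i =>
    chebWMatrix fun j => b i j + (b i j)⁻¹ with hM
  have hMdet : ∀ i, IsUnit (M i).det := by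
    intro i
    rw [hM, det_chebWMatrix, isUnit_iff_ne_zero, Matrix.det_vandermonde_ne_zero_iff]
    intro j j' h
    exact (hbinj _ _ _ _ (add_inv_injOn (hbmem i j) (hbmem i j') h)).2
  have hinv : ∀ (i : Fin k) (r : Fin n), ∑ j, (M i)⁻¹ (s i) j * M i j r =
      if s i = r then 1 else 0 := by
    intro i r
    rw [← Matrix.mul_apply, Matrix.nonsing_inv_mul _ (hMdet i), Matrix.one_apply]
  calc x s = ∑ r, x r * ∏ i, ∑ j, (M i)⁻¹ (s i) j * M i j (r i) := by
        simp_rw [hinv]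
        rw [Finset.sum_eq_single s]
        · simp
        · intro r _ hr
          obtain ⟨i, hi⟩ := Function.ne_iff.mp hr.symm
          rw [Finset.prod_eq_zero (Finset.mem_univ i) (if_neg hi), mul_zero]
        · simp
    _ = ∑ r, ∑ j : Fin k → Fin n, (∏ i, (M i)⁻¹ (s i) (j i)) *
          (x r * ∏ i, M i (j i) (r i)) := by
        refine Finset.sum_congr rfl fun r _ => ?_
        rw [Finset.prod_univ_sum, Fintype.piFinset_univ, Finset.mul_sum]
        refine Finset.sum_congr rfl fun j _ => ?_
        rw [Finset.prod_mul_distrib]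
        ring
    _ = 0 := by
        rw [Finset.sum_comm]
        refine Finset.sum_eq_zero fun j _ => ?_
        rw [← Finset.mul_sum]
        have := hx (fun i => b i (j i)) (fun i i' h => (hbinj _ _ _ _ h).1)
          (fun i => hbmem i (j i))
        rw [show ∑ r, x r * ∏ i, M i (j i) (r i) = 0 from this, mul_zero]

end TopCoordinate

section Antipalindromic

/-- The polynomial `χ` with `P(z) = (1 - z) z ^ m χ(z + z⁻¹)` for an antipalindromic polynomial `P`
of degree `2 m + 1`. -/
noncomputable def halvedPoly (m : ℕ) (P : ℝ[X]) : ℝ[X] :=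
  ∑ r ∈ Finset.range (m + 1), C (P.coeff r) * chebW ℝ (m - r)

variable {m : ℕ} {P : ℝ[X]}

lemma halvedPoly_monic_natDegree (h0 : P.coeff 0 = 1) :
    (halvedPoly m P).Monic ∧ (halvedPoly m P).natDegree = m := by
  rw [halvedPoly, Finset.sum_range_succ', h0, C_1, one_mul, Nat.sub_zero, add_comm]
  have hlt : (∑ r ∈ Finset.range m, C (P.coeff (r + 1)) * chebW ℝ (m - (r + 1))).degree <
      (chebW ℝ m).degree := by
    rw [degree_eq_natDegree (chebW_monic m).ne_zero, natDegree_chebW]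
    refine (degree_sum_le _ _).trans_lt ((Finset.sup_lt_iff (by simp)).mpr fun r hr => ?_)
    rw [Finset.mem_range] at hr
    refine (degree_mul_le _ _).trans_lt ((add_le_add_left degree_C_le _).trans_lt ?_)
    rw [zero_add, degree_eq_natDegree (chebW_monic _).ne_zero, natDegree_chebW]
    exact_mod_cast (by lia : m - (r + 1) < m)
  exact ⟨(chebW_monic m).add_of_left hlt,
    (natDegree_eq_of_degree_eq (degree_add_eq_left_of_degree_lt hlt)).trans (natDegree_chebW m)⟩

lemma eq_sum_of_antipalindromic (hdeg : P.natDegree ≤ 2 * m + 1)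
    (hP : ∀ r ≤ 2 * m + 1, P.coeff (2 * m + 1 - r) = -P.coeff r) :
    P = ∑ r ∈ Finset.range (m + 1), C (P.coeff r) * (X ^ r - X ^ (2 * m + 1 - r)) := by
  conv_lhs => rw [P.as_sum_range_C_mul_X_pow' (n := (m + 1) + (m + 1)) (by lia),
    Finset.sum_range_add]
  simp_rw [mul_sub]
  rw [Finset.sum_sub_distrib, sub_eq_add_neg]
  congr 1
  rw [← Finset.sum_range_reflect, ← Finset.sum_neg_distrib]
  refine Finset.sum_congr rfl fun r hr => ?_
  rw [Finset.mem_range] at hr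
  rw [show m + 1 + (m + 1 - 1 - r) = 2 * m + 1 - r by lia, hP r (by lia), C_neg, neg_mul]

lemma aeval_eq_mul_aeval_halvedPoly {K : Type*} [Field K] [Algebra ℝ K]
    (hdeg : P.natDegree ≤ 2 * m + 1)
    (hP : ∀ r ≤ 2 * m + 1, P.coeff (2 * m + 1 - r) = -P.coeff r) {z : K} (hz : z ≠ 0) :
    aeval z P = (1 - z) * z ^ m * aeval (z + z⁻¹) (halvedPoly m P) := by
  conv_lhs => rw [eq_sum_of_antipalindromic hdeg hP]
  rw [halvedPoly, map_sum, map_sum, Finset.mul_sum]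
  refine Finset.sum_congr rfl fun r hr => ?_
  rw [Finset.mem_range] at hr
  have h1 := one_sub_mul_pow_mul_eval_chebW hz (m - r)
  have h2 : aeval (z + z⁻¹) (chebW ℝ (m - r)) = (chebW K (m - r)).eval (z + z⁻¹) := by
    rw [← map_chebW (algebraMap ℝ K), eval_map_algebraMap]
  rw [map_mul, map_mul, h2, map_sub, map_pow, map_pow, aeval_X, aeval_C, aeval_C]
  have e1 : z ^ (2 * m + 1 - r) = z ^ r * z ^ (2 * (m - r) + 1) := by
    rw [← pow_add]; congr 1; lia
  have e2 : z ^ m = z ^ r * z ^ (m - r) := by rw [← pow_add]; congr 1; lia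
  rw [e1, e2]
  linear_combination (-(algebraMap ℝ K (P.coeff r)) * z ^ r) * h1

lemma jacobiOp_halvedPoly_eval (hdeg : P.natDegree ≤ 2 * m + 1)
    (hP : ∀ r ≤ 2 * m + 1, P.coeff (2 * m + 1 - r) = -P.coeff r) {a : ℝ} (ha : a ≠ 0) :
    a ^ 2 * (derivative (derivative P)).eval a - 2 * m * (a * (derivative P).eval a) =
      (1 - a) * a ^ m * ((jacobiOp (halvedPoly m P)).eval (a + a⁻¹) -
        m * (m + 1) * (halvedPoly m P).eval (a + a⁻¹)) := by
  have hpow : ∀ r : ℕ, a ^ 2 * (derivative (derivative (X ^ r : ℝ[X]))).eval a -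
      2 * m * (a * (derivative (X ^ r : ℝ[X])).eval a) = (r * (r - 1) - 2 * m * r) * a ^ r := by
    intro r
    rcases r with _ | _ | r
    · simp
    · simp
    · simp
      ring
  have hL : a ^ 2 * (derivative (derivative P)).eval a - 2 * m * (a * (derivative P).eval a) =
      ∑ r ∈ Finset.range (m + 1), P.coeff r * ((r * (r - 1) - 2 * m * r) * a ^ r -
        ((2 * m + 1 - r : ℕ) * ((2 * m + 1 - r : ℕ) - 1) - 2 * m * (2 * m + 1 - r : ℕ)) *
          a ^ (2 * m + 1 - r)) := by
    conv_lhs => rw [eq_sum_of_antipalindromic hdeg hP]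
    simp only [derivative_sum, eval_finsetSum, derivative_C_mul, derivative_sub, eval_mul,
      eval_C, eval_sub, Finset.mul_sum, ← Finset.sum_sub_distrib]
    refine Finset.sum_congr rfl fun r _ => ?_
    rw [← hpow, ← hpow]
    ring
  rw [hL, halvedPoly, jacobiOp_sum, eval_finsetSum, eval_finsetSum, Finset.mul_sum (a := (m * (m + 1) : ℝ)),
    ← Finset.sum_sub_distrib, Finset.mul_sum]
  refine Finset.sum_congr rfl fun r hr => ?_
  rw [Finset.mem_range] at hr
  have h1 := one_sub_mul_pow_mul_eval_chebW ha (m - r)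
  rw [jacobiOp_C_mul, jacobiOp_chebW]
  simp only [eval_mul, eval_C]
  have e1 : a ^ (2 * m + 1 - r) = a ^ r * a ^ (2 * (m - r) + 1) := by
    rw [← pow_add]; congr 1; lia
  have e2 : a ^ m = a ^ r * a ^ (m - r) := by rw [← pow_add]; congr 1; lia
  rw [e1, e2, Nat.cast_sub (by lia : r ≤ m), Nat.cast_sub (by lia : r ≤ 2 * m + 1)]
  push_cast
  linear_combination (-(P.coeff r) * a ^ r * (r * (r - 1) - 2 * m * r)) * h1

lemma derivative_eval_halvedPoly (hdeg : P.natDegree ≤ 2 * m + 1)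
    (hP : ∀ r ≤ 2 * m + 1, P.coeff (2 * m + 1 - r) = -P.coeff r) {a : ℝ} (ha : a ≠ 0) :
    a * (derivative P).eval a =
      a ^ m * ((m * (1 - a) - a) * (halvedPoly m P).eval (a + a⁻¹) +
        (1 - a) * (a - a⁻¹) * (derivative (halvedPoly m P)).eval (a + a⁻¹)) := by
  set χ := halvedPoly m P
  have h1 : HasDerivAt (fun z : ℝ => (1 - z) * z ^ m * χ.eval (z + z⁻¹))
      (((-1) * a ^ m + (1 - a) * (m * a ^ (m - 1))) * χ.eval (a + a⁻¹) +
        (1 - a) * a ^ m * ((derivative χ).eval (a + a⁻¹) * (1 + -(a ^ 2)⁻¹))) a := by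
    have hA : HasDerivAt (fun z : ℝ => z + z⁻¹) (1 + -(a ^ 2)⁻¹) a :=
      (hasDerivAt_id a).add (hasDerivAt_inv ha)
    have hB : HasDerivAt (fun z : ℝ => (1 - z)) (-1) a := (hasDerivAt_id a).const_sub 1
    have hC : HasDerivAt (fun z : ℝ => χ.eval (z + z⁻¹))
        ((derivative χ).eval (a + a⁻¹) * (1 + -(a ^ 2)⁻¹)) a :=
      HasDerivAt.comp (h₂ := fun y => χ.eval y) a (χ.hasDerivAt (a + a⁻¹)) hA
    exact (hB.mul (hasDerivAt_pow m a)).mul hC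
  have h2 : HasDerivAt (fun z : ℝ => (1 - z) * z ^ m * χ.eval (z + z⁻¹))
      ((derivative P).eval a) a := by
    refine (P.hasDerivAt a).congr_of_eventuallyEq ?_
    filter_upwards [isOpen_ne.mem_nhds ha] with z hz
    have := aeval_eq_mul_aeval_halvedPoly hdeg hP (z := z) hz
    simp only [coe_aeval_eq_eval] at this
    exact this.symm
  rw [h2.unique h1]
  have e : (m : ℝ) * a ^ (m - 1) * a = m * a ^ m := by
    rcases m with _ | m
    · simp
    · rw [Nat.add_sub_cancel, pow_succ]; ring
  generalize χ.eval (a + a⁻¹) = x at *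
  generalize (derivative χ).eval (a + a⁻¹) = y
  field_simp
  linear_combination (1 - a) * a * x * e

end Antipalindromic

section Resolvent

variable {n : Type*} [Fintype n] [DecidableEq n]

/-- The matrix `(1 - a u)⁻¹ - 1 = (1 - a u)⁻¹ a u`. -/
noncomputable def resolventPart (u : Matrix n n ℝ) (a : ℝ) : Matrix n n ℝ := (1 - a • u)⁻¹ - 1

variable {u : Matrix n n ℝ} {a b : ℝ}

lemma det_one_sub_smul_ne_zero (hu : uᵀ * u = 1) (ha : a ∈ Set.Ioo (0 : ℝ) 1) :
    (1 - a • u).det ≠ 0 := by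
  intro h
  obtain ⟨v, hv, hv0⟩ := Matrix.exists_mulVec_eq_zero_iff.mpr h
  rw [Matrix.sub_mulVec, Matrix.one_mulVec, Matrix.smul_mulVec, sub_eq_zero] at hv0
  have h1 : v ⬝ᵥ v = a ^ 2 * (v ⬝ᵥ v) := by
    conv_lhs => rw [hv0, smul_dotProduct, dotProduct_smul, Matrix.dotProduct_mulVec,
      Matrix.vecMul_mulVec, hu, Matrix.vecMul_one]
    simp only [smul_eq_mul]
    ring
  have h2 : v ⬝ᵥ v ≠ 0 := fun h => hv (dotProduct_self_eq_zero.mp h)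
  have h3 : (1 - a ^ 2) * (v ⬝ᵥ v) = 0 := by linear_combination h1
  rcases mul_eq_zero.mp h3 with h | h
  · nlinarith [ha.1, ha.2]
  · exact h2 h

lemma resolventPart_eq (ha : (1 - a • u).det ≠ 0) :
    resolventPart u a = (1 - a • u)⁻¹ * (a • u) := by
  have h : (1 - a • u)⁻¹ * (1 - a • u) = 1 := Matrix.nonsing_inv_mul _ ha.isUnit
  rw [resolventPart]
  nth_rewrite 2 [← h]
  rw [← mul_one_sub, sub_sub_cancel]

lemma resolventPart_eq' (ha : (1 - a • u).det ≠ 0) :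
    resolventPart u a = (a • u) * (1 - a • u)⁻¹ := by
  have h : (1 - a • u) * (1 - a • u)⁻¹ = 1 := Matrix.mul_nonsing_inv _ ha.isUnit
  rw [resolventPart]
  nth_rewrite 2 [← h]
  rw [← one_sub_mul, sub_sub_cancel]

lemma sub_smul_resolventPart_mul (ha : (1 - a • u).det ≠ 0) (hb : (1 - b • u).det ≠ 0) :
    (a - b) • (resolventPart u a * resolventPart u b) =
      b • resolventPart u a - a • resolventPart u b := by
  have h₁' : (1 - a • u)⁻¹ * (1 - a • u) = 1 := Matrix.nonsing_inv_mul _ ha.isUnit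
  have h₂ : (1 - b • u) * (1 - b • u)⁻¹ = 1 := Matrix.mul_nonsing_inv _ hb.isUnit
  have key : b • (1 - a • u) - a • (1 - b • u) = (b - a) • (1 : Matrix n n ℝ) := by
    simp only [smul_sub, sub_smul, smul_smul, mul_comm]
    abel
  have key' : b • (1 - b • u)⁻¹ - a • (1 - a • u)⁻¹ =
      (b - a) • ((1 - a • u)⁻¹ * (1 - b • u)⁻¹) := by
    calc _ = (1 - a • u)⁻¹ * (b • (1 - a • u) - a • (1 - b • u)) * (1 - b • u)⁻¹ := by
          rw [mul_sub, sub_mul, Matrix.mul_smul, Matrix.mul_smul, Matrix.smul_mul, Matrix.smul_mul,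
            mul_assoc _ (1 - b • u), h₂, h₁', one_mul, mul_one]
      _ = _ := by rw [key]; simp
  simp only [resolventPart, sub_mul, mul_sub, one_mul, mul_one]
  rw [smul_sub, smul_sub (a - b), ← neg_sub b a, neg_smul, ← key']
  simp only [smul_sub, sub_smul, neg_sub]
  abel

lemma sub_mul_trace_resolventPart_mul (ha : (1 - a • u).det ≠ 0) (hb : (1 - b • u).det ≠ 0) :
    (a - b) * (resolventPart u a * resolventPart u b).trace =
      b * (resolventPart u a).trace - a * (resolventPart u b).trace := by
  simpa using congrArg Matrix.trace (sub_smul_resolventPart_mul ha hb)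

lemma one_sub_mul_mul_trace_resolventPart_mul_transpose (hu : uᵀ * u = 1)
    (ha : (1 - a • u).det ≠ 0) (hb : (1 - b • u).det ≠ 0) :
    (1 - a * b) * (resolventPart u a * (resolventPart u b)ᵀ).trace =
      a * b * (Fintype.card n + (resolventPart u a).trace + (resolventPart u b).trace) := by
  have hu' : u * uᵀ = 1 := mul_eq_one_comm.mp hu
  have hbt : (1 - b • uᵀ).det ≠ 0 := by
    rwa [← Matrix.det_transpose, Matrix.transpose_sub, Matrix.transpose_one, Matrix.transpose_smul,
      Matrix.transpose_transpose]
  have ht : (resolventPart u b)ᵀ = resolventPart uᵀ b := by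
    simp [resolventPart, Matrix.transpose_nonsing_inv]
  have h₁ : (1 - a • u)⁻¹ * (1 - a • u) = 1 := Matrix.nonsing_inv_mul _ ha.isUnit
  have h₂ : (1 - b • uᵀ) * (1 - b • uᵀ)⁻¹ = 1 := Matrix.mul_nonsing_inv _ hbt.isUnit
  have key : (1 - b • uᵀ) + (1 - a • u) - (1 - a • u) * (1 - b • uᵀ) =
      (1 - a * b) • (1 : Matrix n n ℝ) := by
    simp only [mul_sub, sub_mul, Matrix.mul_smul, Matrix.smul_mul, hu', one_mul, mul_one,
      sub_smul, smul_smul, one_smul, mul_comm]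
    abel
  have key' : (1 - a • u)⁻¹ + (1 - b • uᵀ)⁻¹ - 1 =
      (1 - a * b) • ((1 - a • u)⁻¹ * (1 - b • uᵀ)⁻¹) := by
    calc _ = (1 - a • u)⁻¹ * ((1 - b • uᵀ) + (1 - a • u) - (1 - a • u) * (1 - b • uᵀ)) *
          (1 - b • uᵀ)⁻¹ := by
          rw [mul_sub, mul_add, sub_mul, add_mul, mul_assoc _ (1 - b • uᵀ), h₂, h₁, ← mul_assoc,
            h₁, mul_one, one_mul, one_mul, h₂]
      _ = _ := by rw [key]; simp
  have hmul : (1 - a * b) • (resolventPart u a * (resolventPart u b)ᵀ) =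
      (a * b) • (1 + resolventPart u a + (resolventPart u b)ᵀ) := by
    rw [ht, resolventPart_eq ha, resolventPart_eq' hbt]
    have : (1 - a • u)⁻¹ * (a • u) * (b • uᵀ * (1 - b • uᵀ)⁻¹) =
        (a * b) • ((1 - a • u)⁻¹ * (1 - b • uᵀ)⁻¹) := by
      rw [mul_assoc, ← mul_assoc (a • u), Matrix.smul_mul, Matrix.mul_smul, hu', smul_smul]
      simp
    rw [this, smul_comm, ← key', ← resolventPart_eq ha, ← resolventPart_eq' hbt, resolventPart,
      resolventPart]
    congr 1
    abel
  have htr := congrArg Matrix.trace hmul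
  simp only [Matrix.trace_smul, Matrix.trace_add, Matrix.trace_one, Matrix.trace_transpose,
    smul_eq_mul] at htr
  exact htr

lemma aeval_charpolyRev {K : Type*} [Field K] [Algebra ℝ K] (u : Matrix n n ℝ) (z : K) :
    aeval z u.charpolyRev = (1 - z • u.map (algebraMap ℝ K)).det := by
  rw [Matrix.charpolyRev, AlgHom.map_det]
  congr 1
  ext i j
  by_cases h : i = j <;> simp [h] <;> ring

lemma eval_charpolyRev_real (u : Matrix n n ℝ) (z : ℝ) :
    u.charpolyRev.eval z = (1 - z • u).det := by
  have := aeval_charpolyRev u z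
  simpa [coe_aeval_eq_eval] using this

lemma mul_derivative_charpolyRev (ha : (1 - a • u).det ≠ 0) :
    a * (derivative u.charpolyRev).eval a =
      -(u.charpolyRev.eval a * (resolventPart u a).trace) := by
  have h : u.charpolyRev.comp (C a + C a * X) =
      C (u.charpolyRev.eval a) * (resolventPart u a).charpolyRev := by
    refine Polynomial.funext fun h => ?_
    simp only [eval_comp, eval_add, eval_C, eval_mul, eval_X, eval_charpolyRev_real]
    rw [← Matrix.det_mul, resolventPart_eq ha]
    congr 1
    rw [mul_sub, Matrix.mul_smul, ← mul_assoc, Matrix.mul_nonsing_inv _ ha.isUnit, one_mul, mul_one,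
      add_smul, smul_smul, mul_comm h a]
    abel
  have h1 := congrArg (fun p => (derivative p).eval 0) h
  simp only [derivative_comp, derivative_C_mul, derivative_add, derivative_C, derivative_X,
    eval_mul, eval_add, eval_comp, eval_C, eval_X, zero_add, mul_zero,
    add_zero, mul_one] at h1
  have h2 : (derivative (resolventPart u a).charpolyRev).eval 0 = -(resolventPart u a).trace := by
    rw [← coeff_zero_eq_eval_zero, coeff_derivative]
    simp
  rw [h1, h2, mul_neg]

lemma hasDerivAt_trace_resolventPart_div (ha0 : a ≠ 0) (ha : (1 - a • u).det ≠ 0) :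
    HasDerivAt (fun b => (resolventPart u b).trace / b)
      ((resolventPart u a * resolventPart u a).trace / a ^ 2) a := by
  have hcd : Continuous fun b : ℝ => (1 - b • u).det := by fun_prop
  have hev : ∀ᶠ b in nhds a, (1 - b • u).det ≠ 0 ∧ b ≠ 0 :=
    (hcd.continuousAt.eventually_ne ha).and (continuousAt_id.eventually_ne ha0)
  have hinv : ContinuousAt (fun b : ℝ => (1 - b • u)⁻¹) a := by
    simp only [Matrix.inv_def, Ring.inverse_eq_inv']
    refine ContinuousAt.smul (hcd.continuousAt.inv₀ ha) ?_
    exact (Continuous.matrix_adjugate (by fun_prop)).continuousAt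
  have hR : ContinuousAt (fun b : ℝ => (resolventPart u a * resolventPart u b).trace / (a * b))
      a := by
    refine ContinuousAt.div ?_ (by fun_prop) (mul_ne_zero ha0 ha0)
    have hc : Continuous fun M : Matrix n n ℝ => (resolventPart u a * (M - 1)).trace := by fun_prop
    exact hc.continuousAt.comp (f := fun b : ℝ => (1 - b • u)⁻¹) hinv
  rw [hasDerivAt_iff_tendsto_slope, pow_two]
  refine (hR.tendsto.mono_left nhdsWithin_le_nhds).congr' ?_
  filter_upwards [nhdsWithin_le_nhds hev, self_mem_nhdsWithin] with b hb hba
  have hba' : b - a ≠ 0 := sub_ne_zero.mpr hba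
  have hb0 := hb.2
  have := sub_mul_trace_resolventPart_mul ha hb.1
  rw [slope_def_field]
  field_simp
  linear_combination -this

lemma sq_mul_derivative_derivative_charpolyRev (ha0 : a ≠ 0) (ha : (1 - a • u).det ≠ 0) :
    a ^ 2 * (derivative (derivative u.charpolyRev)).eval a =
      u.charpolyRev.eval a * ((resolventPart u a).trace ^ 2 -
        (resolventPart u a * resolventPart u a).trace) := by
  have hcd : Continuous fun b : ℝ => (1 - b • u).det := by fun_prop
  have hev : ∀ᶠ b in nhds a, (1 - b • u).det ≠ 0 ∧ b ≠ 0 :=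
    (hcd.continuousAt.eventually_ne ha).and (continuousAt_id.eventually_ne ha0)
  have hPa : u.charpolyRev.eval a ≠ 0 := by rwa [eval_charpolyRev_real]
  have h1 := ((derivative u.charpolyRev).hasDerivAt a).div (u.charpolyRev.hasDerivAt a) hPa
  have h2 : HasDerivAt (fun b => (resolventPart u b).trace / b) _ a :=
    h1.neg.congr_of_eventuallyEq (by
      filter_upwards [hev] with b hb
      have h3 := mul_derivative_charpolyRev hb.1
      have hPb : u.charpolyRev.eval b ≠ 0 := by rw [eval_charpolyRev_real]; exact hb.1
      have hb0 := hb.2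
      simp only [Pi.neg_apply, Pi.div_apply]
      field_simp
      linear_combination h3)
  have h4 := h2.unique (hasDerivAt_trace_resolventPart_div ha0 ha)
  have h5 := mul_derivative_charpolyRev ha
  field_simp at h4
  have h6 : u.charpolyRev.eval a * (a ^ 2 * (derivative (derivative u.charpolyRev)).eval a) =
      u.charpolyRev.eval a * (u.charpolyRev.eval a * ((resolventPart u a).trace ^ 2 -
        (resolventPart u a * resolventPart u a).trace)) := by
    linear_combination -h4 + (a * (derivative u.charpolyRev).eval a -
      u.charpolyRev.eval a * (resolventPart u a).trace) * h5
  exact mul_left_cancel₀ hPa h6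

end Resolvent

section PointwiseIdentities

variable {m : ℕ} {u : Matrix (Fin (2 * m + 1)) (Fin (2 * m + 1)) ℝ} {a b : ℝ}

lemma charpolyRev_eq_neg_charpoly (hu : uᵀ * u = 1) (hdet : u.det = 1) :
    u.charpolyRev = -u.charpoly := by
  refine Polynomial.funext fun z => ?_
  rw [eval_charpolyRev_real, eval_neg, Matrix.eval_charpoly]
  calc (1 - z • u).det = (uᵀ * (1 - z • u)).det := by
        rw [Matrix.det_mul, Matrix.det_transpose, hdet, one_mul]
    _ = ((-(Matrix.scalar _ z - u))ᵀ).det := by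
        congr 1
        rw [mul_sub, Matrix.mul_smul, hu, mul_one, neg_sub, Matrix.transpose_sub,
          Matrix.scalar_apply, Matrix.diagonal_transpose, Matrix.smul_one_eq_diagonal]
    _ = _ := by
        rw [Matrix.det_transpose, Matrix.det_neg, Fintype.card_fin,
          Odd.neg_one_pow ⟨m, rfl⟩, neg_one_mul]

lemma natDegree_charpolyRev_le (hu : uᵀ * u = 1) (hdet : u.det = 1) :
    u.charpolyRev.natDegree ≤ 2 * m + 1 := by
  rw [charpolyRev_eq_neg_charpoly hu hdet, natDegree_neg, Matrix.charpoly_natDegree_eq_dim,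
    Fintype.card_fin]

lemma coeff_charpolyRev_antipalindromic (hu : uᵀ * u = 1) (hdet : u.det = 1) (r : ℕ)
    (hr : r ≤ 2 * m + 1) : u.charpolyRev.coeff (2 * m + 1 - r) = -u.charpolyRev.coeff r := by
  have h := u.reverse_charpoly
  conv_rhs => rw [← h, coeff_reverse, Matrix.charpoly_natDegree_eq_dim, Fintype.card_fin,
    revAt_le hr]
  rw [charpolyRev_eq_neg_charpoly hu hdet, coeff_neg]

lemma coeff_zero_charpolyRev {n : Type*} [Fintype n] [DecidableEq n] (u : Matrix n n ℝ) :
    u.charpolyRev.coeff 0 = 1 := by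
  rw [coeff_zero_eq_eval_zero, Matrix.eval_charpolyRev]

lemma eval_charpolyRev_eq_mul_eval_halvedPoly (hu : uᵀ * u = 1) (hdet : u.det = 1) (ha : a ≠ 0) :
    u.charpolyRev.eval a = (1 - a) * a ^ m * (halvedPoly m u.charpolyRev).eval (a + a⁻¹) := by
  have := aeval_eq_mul_aeval_halvedPoly (natDegree_charpolyRev_le hu hdet)
    (coeff_charpolyRev_antipalindromic hu hdet) ha
  simpa [coe_aeval_eq_eval] using this

lemma halvedPoly_charpolyRev_eval_ne_zero (hu : uᵀ * u = 1) (hdet : u.det = 1)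
    (ha : a ∈ Set.Ioo (0 : ℝ) 1) : (halvedPoly m u.charpolyRev).eval (a + a⁻¹) ≠ 0 := by
  intro h
  have h1 := eval_charpolyRev_eq_mul_eval_halvedPoly hu hdet ha.1.ne'
  rw [h, mul_zero, eval_charpolyRev_real] at h1
  exact det_one_sub_smul_ne_zero hu ha h1

lemma jacobiOp_halvedPoly_charpolyRev_div (hu : uᵀ * u = 1) (hdet : u.det = 1)
    (ha : a ∈ Set.Ioo (0 : ℝ) 1) :
    (jacobiOp (halvedPoly m u.charpolyRev)).eval (a + a⁻¹) /
        (halvedPoly m u.charpolyRev).eval (a + a⁻¹) - m * (m + 1) =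
      2 * m * (resolventPart u a).trace + (resolventPart u a).trace ^ 2 -
        (resolventPart u a * resolventPart u a).trace := by
  have ha0 := ha.1.ne'
  have hd := det_one_sub_smul_ne_zero hu ha
  have h1 := jacobiOp_halvedPoly_eval (natDegree_charpolyRev_le hu hdet)
    (coeff_charpolyRev_antipalindromic hu hdet) ha0
  rw [sq_mul_derivative_derivative_charpolyRev ha0 hd, mul_derivative_charpolyRev hd,
    eval_charpolyRev_eq_mul_eval_halvedPoly hu hdet ha0] at h1
  have hx := halvedPoly_charpolyRev_eval_ne_zero hu hdet ha
  have hc : (1 - a) * a ^ m ≠ 0 := mul_ne_zero (sub_ne_zero.mpr ha.2.ne') (pow_ne_zero _ ha0)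
  rw [div_sub' hx, div_eq_iff hx]
  refine mul_left_cancel₀ hc ?_
  linear_combination -h1

lemma mul_derivative_halvedPoly_charpolyRev_div (hu : uᵀ * u = 1) (hdet : u.det = 1)
    (ha : a ∈ Set.Ioo (0 : ℝ) 1) :
    (a - a⁻¹) * ((derivative (halvedPoly m u.charpolyRev)).eval (a + a⁻¹) /
        (halvedPoly m u.charpolyRev).eval (a + a⁻¹)) =
      a / (1 - a) - m - (resolventPart u a).trace := by
  have ha0 := ha.1.ne'
  have hd := det_one_sub_smul_ne_zero hu ha
  have h1 := derivative_eval_halvedPoly (natDegree_charpolyRev_le hu hdet)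
    (coeff_charpolyRev_antipalindromic hu hdet) ha0
  rw [mul_derivative_charpolyRev hd, eval_charpolyRev_eq_mul_eval_halvedPoly hu hdet ha0] at h1
  have hx := halvedPoly_charpolyRev_eval_ne_zero hu hdet ha
  have h1a : 1 - a ≠ 0 := sub_ne_zero.mpr ha.2.ne'
  generalize (halvedPoly m u.charpolyRev).eval (a + a⁻¹) = x at *
  generalize (derivative (halvedPoly m u.charpolyRev)).eval (a + a⁻¹) = y at *
  have h2 := mul_left_cancel₀ (pow_ne_zero m ha0)
    (show a ^ m * (-((1 - a) * x * (resolventPart u a).trace)) = _ by rw [← h1]; ring)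
  rw [← mul_div_assoc, div_eq_iff hx]
  refine mul_left_cancel₀ h1a ?_
  rw [show (1 - a) * ((a / (1 - a) - m - (resolventPart u a).trace) * x) =
    (a - (1 - a) * (m + (resolventPart u a).trace)) * x by field_simp; ring]
  linear_combination -h2

lemma divided_difference_halvedPoly_charpolyRev (hu : uᵀ * u = 1) (hdet : u.det = 1)
    (ha : a ∈ Set.Ioo (0 : ℝ) 1) (hb : b ∈ Set.Ioo (0 : ℝ) 1) (hab : a ≠ b) :
    (((a + a⁻¹) ^ 2 - 4) * ((derivative (halvedPoly m u.charpolyRev)).eval (a + a⁻¹) /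
        (halvedPoly m u.charpolyRev).eval (a + a⁻¹)) -
      ((b + b⁻¹) ^ 2 - 4) * ((derivative (halvedPoly m u.charpolyRev)).eval (b + b⁻¹) /
        (halvedPoly m u.charpolyRev).eval (b + b⁻¹))) / ((a + a⁻¹) - (b + b⁻¹)) - m =
      (resolventPart u a * (resolventPart u b)ᵀ).trace -
        (resolventPart u a * resolventPart u b).trace := by
  have ha0 := ha.1.ne'
  have hb0 := hb.1.ne'
  have h1a : 1 - a ≠ 0 := sub_ne_zero.mpr ha.2.ne'
  have h1b : 1 - b ≠ 0 := sub_ne_zero.mpr hb.2.ne'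
  have hda := det_one_sub_smul_ne_zero hu ha
  have hdb := det_one_sub_smul_ne_zero hu hb
  have h1 := sub_mul_trace_resolventPart_mul hda hdb
  have h2 := one_sub_mul_mul_trace_resolventPart_mul_transpose hu hda hdb
  have hs : ∀ x : ℝ, x ≠ 0 → ∀ y : ℝ, ((x + x⁻¹) ^ 2 - 4) * y = (x - x⁻¹) * ((x - x⁻¹) * y) := by
    intro x hx y; field_simp; ring
  rw [hs a ha0, hs b hb0, mul_derivative_halvedPoly_charpolyRev_div hu hdet ha,
    mul_derivative_halvedPoly_charpolyRev_div hu hdet hb]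
  have hab' : a - b ≠ 0 := sub_ne_zero.mpr hab
  have hab1 : 1 - a * b ≠ 0 := by nlinarith [ha.1, ha.2, hb.1, hb.2]
  have hAB : (a + a⁻¹) - (b + b⁻¹) = -((a - b) * (1 - a * b)) / (a * b) := by
    field_simp; ring
  rw [hAB]
  rw [Fintype.card_fin] at h2
  push_cast at h2
  generalize (resolventPart u a * (resolventPart u b)ᵀ).trace = x at *
  generalize (resolventPart u a * resolventPart u b).trace = y at *
  generalize (resolventPart u a).trace = s at *
  generalize (resolventPart u b).trace = t at *
  have hx : x = a * b * (2 * m + 1 + s + t) / (1 - a * b) := by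
    rw [eq_div_iff hab1]; linear_combination h2
  have hy : y = (b * s - a * t) / (a - b) := by
    rw [eq_div_iff hab']; linear_combination h1
  rw [hx, hy]
  field_simp
  ring

end PointwiseIdentities

section PlaneRotation

variable {n : Type*} [Fintype n] [DecidableEq n]

/-- The inclusion of the coordinate plane spanned by the vectors `p` and `q`. -/
def planeFrame (p q : n) : Matrix n (Fin 2) ℝ := (1 : Matrix n n ℝ).submatrix id ![p, q]

/-- The difference between the plane rotation with half-angle tangent `h` and the identity. -/
noncomputable def planeKernel (h : ℝ) : Matrix (Fin 2) (Fin 2) ℝ :=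
  (1 + h ^ 2)⁻¹ • !![-2 * h ^ 2, 2 * h; -2 * h, -2 * h ^ 2]

/-- The rotation with half-angle tangent `h` in the coordinate plane spanned by `p` and `q`. -/
noncomputable def planeRotation (p q : n) (h : ℝ) : Matrix n n ℝ :=
  1 + planeFrame p q * planeKernel h * (planeFrame p q)ᵀ

lemma planeFrame_transpose_mul_mul (p q : n) (R : Matrix n n ℝ) :
    (planeFrame p q)ᵀ * R * planeFrame p q = R.submatrix ![p, q] ![p, q] := by
  ext i j
  simp only [planeFrame, Matrix.mul_apply, Matrix.transpose_apply, Matrix.submatrix_apply, id_eq,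
    Matrix.one_apply, ite_mul, mul_ite, one_mul, mul_one, zero_mul, mul_zero, Finset.sum_ite_eq',
    Finset.mem_univ, if_true]

lemma planeFrame_transpose_mul {p q : n} (hpq : p ≠ q) :
    (planeFrame p q)ᵀ * planeFrame p q = 1 := by
  have h := planeFrame_transpose_mul_mul p q 1
  rw [Matrix.mul_one] at h
  rw [h]
  ext i j
  fin_cases i <;> fin_cases j <;> simp [Matrix.one_apply, hpq, hpq.symm]

lemma planeKernel_add_transpose_add_mul (h : ℝ) :
    planeKernel h + (planeKernel h)ᵀ + (planeKernel h)ᵀ * planeKernel h = 0 := by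
  have h0 : 1 + h ^ 2 ≠ 0 := by positivity
  ext i j
  fin_cases i <;> fin_cases j <;>
    simp [planeKernel, Matrix.mul_apply, Fin.sum_univ_two] <;> field_simp <;> ring

lemma planeRotation_transpose_mul {p q : n} (hpq : p ≠ q) (h : ℝ) :
    (planeRotation p q h)ᵀ * planeRotation p q h = 1 := by
  set U := planeFrame p q
  set K := planeKernel h
  have hU : Uᵀ * U = 1 := planeFrame_transpose_mul hpq
  have hr : planeRotation p q h = 1 + U * K * Uᵀ := rfl
  have hrt : (planeRotation p q h)ᵀ = 1 + U * Kᵀ * Uᵀ := by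
    rw [hr]; simp [Matrix.transpose_mul, Matrix.mul_assoc]
  have h2 : U * Kᵀ * Uᵀ * (U * K * Uᵀ) = U * (Kᵀ * K) * Uᵀ := by
    calc _ = U * Kᵀ * (Uᵀ * U) * K * Uᵀ := by simp only [Matrix.mul_assoc]
      _ = _ := by rw [hU, Matrix.mul_one]; simp only [Matrix.mul_assoc]
  have h1 : U * (K + Kᵀ + Kᵀ * K) * Uᵀ = 0 := by
    rw [planeKernel_add_transpose_add_mul, Matrix.mul_zero, Matrix.zero_mul]
  rw [hrt, hr, add_mul, mul_add, mul_add, one_mul, one_mul, mul_one, h2]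
  rw [Matrix.mul_add, Matrix.mul_add, Matrix.add_mul, Matrix.add_mul] at h1
  rw [add_assoc, ← add_assoc (U * K * Uᵀ), h1, add_zero]

lemma planeRotation_det {p q : n} (hpq : p ≠ q) (h : ℝ) : (planeRotation p q h).det = 1 := by
  have h0 : 1 + h ^ 2 ≠ 0 := by positivity
  rw [planeRotation, Matrix.mul_assoc, Matrix.det_one_add_mul_comm, Matrix.mul_assoc,
    planeFrame_transpose_mul hpq, Matrix.mul_one, Matrix.det_fin_two]
  simp [planeKernel]
  field_simp
  ring

lemma det_one_sub_smul_planeRotation_mul {u : Matrix n n ℝ} {a : ℝ} (ha : (1 - a • u).det ≠ 0)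
    (p q : n) (h : ℝ) :
    (1 + h ^ 2) * (1 - a • (planeRotation p q h * u)).det =
      (1 - a • u).det *
        (1 - 2 * (resolventPart u a q p - resolventPart u a p q) * h +
          (1 + 2 * (resolventPart u a p p + resolventPart u a q q +
            2 * (resolventPart u a p p * resolventPart u a q q -
              resolventPart u a p q * resolventPart u a q p))) * h ^ 2) := by
  have h0 : 1 + h ^ 2 ≠ 0 := by positivity
  set R := resolventPart u a with hR
  have hRu : R * (1 - a • u) = a • u := by
    rw [hR, resolventPart_eq' ha, mul_assoc, Matrix.nonsing_inv_mul _ ha.isUnit, mul_one]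
  have e : 1 - a • (planeRotation p q h * u) =
      (1 - planeFrame p q * (planeKernel h * (planeFrame p q)ᵀ * R)) * (1 - a • u) := by
    rw [planeRotation, add_mul, one_mul, smul_add, sub_mul (1 : Matrix n n ℝ), one_mul, sub_sub]
    simp only [Matrix.mul_assoc, hRu, Matrix.mul_smul]
  rw [e, Matrix.det_mul, Matrix.det_one_sub_mul_comm, Matrix.mul_assoc, Matrix.mul_assoc,
    ← Matrix.mul_assoc _ R, planeFrame_transpose_mul_mul, Matrix.det_fin_two]
  simp only [planeKernel, Matrix.sub_apply, Matrix.mul_apply, Matrix.smul_apply, Fin.sum_univ_two,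
    Matrix.submatrix_apply, Matrix.of_apply, Matrix.cons_val_zero, Matrix.cons_val_one, smul_eq_mul,
    Matrix.one_apply, Fin.isValue, if_true, zero_ne_one, one_ne_zero, if_false]
  field_simp
  ring

end PlaneRotation

section CoefficientExtraction

lemma coeff_prod_quadratic {ι : Type*} [DecidableEq ι] (s : Finset ι) (b c : ι → ℝ) :
    (∏ i ∈ s, (1 + C (b i) * X + C (c i) * X ^ 2)).coeff 0 = 1 ∧
    (∏ i ∈ s, (1 + C (b i) * X + C (c i) * X ^ 2)).coeff 1 = ∑ i ∈ s, b i ∧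
    2 * (∏ i ∈ s, (1 + C (b i) * X + C (c i) * X ^ 2)).coeff 2 =
      2 * ∑ i ∈ s, c i + (∑ i ∈ s, b i) ^ 2 - ∑ i ∈ s, b i ^ 2 := by
  induction s using Finset.induction_on with
  | empty => simp [coeff_one]
  | insert i s hi ih =>
    obtain ⟨h0, h1, h2⟩ := ih
    have e0 : (1 + C (b i) * X + C (c i) * X ^ 2 : ℝ[X]).coeff 0 = 1 := by simp
    have e1 : (1 + C (b i) * X + C (c i) * X ^ 2 : ℝ[X]).coeff 1 = b i := by
      simp [coeff_X_pow, coeff_one]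
    have e2 : (1 + C (b i) * X + C (c i) * X ^ 2 : ℝ[X]).coeff 2 = c i := by
      simp [coeff_X_pow, coeff_one]
    rw [Finset.prod_insert hi, Finset.sum_insert hi, Finset.sum_insert hi, Finset.sum_insert hi]
    refine ⟨?_, ?_, ?_⟩
    · rw [mul_coeff_zero, e0, h0, one_mul]
    · rw [mul_coeff_one, e0, e1, h0, h1]; ring
    · rw [coeff_mul, Finset.Nat.sum_antidiagonal_eq_sum_range_succ_mk, Finset.sum_range_succ,
        Finset.sum_range_succ, Finset.sum_range_succ, Finset.sum_range_zero]
      simp only [Nat.sub_zero, Nat.sub_self, show 2 - 1 = 1 from rfl, e0, e1, e2, h0, h1]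
      linear_combination h2

lemma sq_sum_sub_sum_sq {ι : Type*} [Fintype ι] [DecidableEq ι] (b : ι → ℝ) :
    (∑ i, b i) ^ 2 - ∑ i, b i ^ 2 = ∑ i, ∑ l ∈ Finset.univ.erase i, b i * b l := by
  rw [pow_two, Finset.sum_mul, ← Finset.sum_sub_distrib]
  refine Finset.sum_congr rfl fun i _ => ?_
  rw [← Finset.add_sum_erase _ b (Finset.mem_univ i), ← Finset.mul_sum]
  ring

lemma two_mul_coeff_two_prod_quadratic {k : ℕ} (b c : Fin k → ℝ) :
    2 * (∏ i, (1 + C (b i) * X + C (c i) * X ^ 2)).coeff 2 =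
      2 * ∑ i, c i + ∑ i, ∑ l ∈ Finset.univ.erase i, b i * b l := by
  rw [(coeff_prod_quadratic Finset.univ b c).2.2, ← sq_sum_sub_sum_sq]
  ring

/-- The coefficients of a family of polynomials depend continuously on the parameter. -/
def ContinuousCoeff {G : Type*} [TopologicalSpace G] (Q : G → ℝ[X]) : Prop :=
  ∀ d, Continuous fun g => (Q g).coeff d

namespace ContinuousCoeff

variable {G : Type*} [TopologicalSpace G]

lemma const (p : ℝ[X]) : ContinuousCoeff fun _ : G => p := fun _ => continuous_const

lemma C {f : G → ℝ} (hf : Continuous f) : ContinuousCoeff fun g => Polynomial.C (f g) := by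
  intro d
  rcases d with _ | d
  · simpa using hf
  · simpa using continuous_const

lemma add {Q₁ Q₂ : G → ℝ[X]} (h₁ : ContinuousCoeff Q₁) (h₂ : ContinuousCoeff Q₂) :
    ContinuousCoeff fun g => Q₁ g + Q₂ g := fun d => by
  simp only [coeff_add]
  exact (h₁ d).add (h₂ d)

lemma mul {Q₁ Q₂ : G → ℝ[X]} (h₁ : ContinuousCoeff Q₁) (h₂ : ContinuousCoeff Q₂) :
    ContinuousCoeff fun g => Q₁ g * Q₂ g := fun d => by
  simp only [coeff_mul]
  exact continuous_finsetSum _ fun x _ => (h₁ _).mul (h₂ _)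

lemma sum {ι : Type*} {s : Finset ι} {Q : ι → G → ℝ[X]} (h : ∀ i, ContinuousCoeff (Q i)) :
    ContinuousCoeff fun g => ∑ i ∈ s, Q i g := fun d => by
  simp only [finsetSum_coeff]
  exact continuous_finsetSum _ fun i _ => h i d

lemma prod {ι : Type*} {s : Finset ι} {Q : ι → G → ℝ[X]} (h : ∀ i, ContinuousCoeff (Q i)) :
    ContinuousCoeff fun g => ∏ i ∈ s, Q i g := by
  classical
  induction s using Finset.induction_on with
  | empty => simpa using const 1
  | insert i s hi ih => simpa [Finset.prod_insert hi] using (h i).mul ih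

end ContinuousCoeff

/-- A polynomial identity for averages can be read off coefficientwise. -/
lemma integral_mul_coeff_eq {G : Type*} [TopologicalSpace G] [CompactSpace G] [MeasurableSpace G]
    [BorelSpace G] {μ : Measure G} [IsFiniteMeasure μ] {D : G → ℝ} (hD : Continuous D)
    {Q : G → ℝ[X]} (hQ : ContinuousCoeff Q) {N : ℕ} (hN : ∀ g, (Q g).natDegree < N) {q : ℝ[X]}
    (h : ∀ x, ∫ g, D g * (Q g).eval x ∂μ = q.eval x) (d : ℕ) :
    ∫ g, D g * (Q g).coeff d ∂μ = q.coeff d := by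
  have hint : ∀ d, Integrable (fun g => D g * (Q g).coeff d) μ := fun d =>
    (hD.mul (hQ d)).integrable_of_hasCompactSupport (HasCompactSupport.of_compactSpace _)
  have hq : q = ∑ e ∈ Finset.range N, Polynomial.C (∫ g, D g * (Q g).coeff e ∂μ) * X ^ e := by
    refine Polynomial.funext fun x => ?_
    rw [← h, eval_finsetSum]
    simp only [eval_mul, eval_C, eval_pow, eval_X]
    simp_rw [← integral_mul_const]
    rw [← integral_finsetSum _ fun e _ => (hint e).mul_const _]
    refine integral_congr_ae (ae_of_all _ fun g => ?_)
    simp only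
    rw [eval_eq_sum_range' (hN g), Finset.mul_sum]
    exact Finset.sum_congr rfl fun e _ => by ring
  rw [hq]
  simp only [finsetSum_coeff, coeff_C_mul, coeff_X_pow, mul_ite, mul_one, mul_zero]
  rw [Finset.sum_ite_eq]
  split_ifs with hd
  · rfl
  · have : ∀ g, (Q g).coeff d = 0 := fun g =>
      coeff_eq_zero_of_natDegree_lt ((hN g).trans_le (by simpa using hd))
    simp [this]

end CoefficientExtraction

section SpecialOrthogonalGroup

variable {N : ℕ}

instance matrix_borelSpace {m n : Type*} [Finite m] [Finite n] : BorelSpace (Matrix m n ℝ) :=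
  inferInstanceAs (BorelSpace (m → n → ℝ))

instance orthogonalGroup_borelSpace : BorelSpace (Matrix.orthogonalGroup (Fin N) ℝ) :=
  Subtype.borelSpace _

instance SOg_borelSpace : BorelSpace (SOg N) := Subtype.borelSpace _

/-- The matrix of an element of the special orthogonal group. -/
def soMat (u : SOg N) : Matrix (Fin N) (Fin N) ℝ :=
  ((u : Matrix.orthogonalGroup (Fin N) ℝ) : Matrix (Fin N) (Fin N) ℝ)

lemma soMat_mul (u v : SOg N) : soMat (u * v) = soMat u * soMat v := rfl

lemma soMat_transpose_mul (u : SOg N) : (soMat u)ᵀ * soMat u = 1 :=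
  (Matrix.mem_orthogonalGroup_iff' (Fin N) ℝ).mp (u : Matrix.orthogonalGroup (Fin N) ℝ).2

lemma soMat_det (u : SOg N) : (soMat u).det = 1 := u.2

/-- The element of the special orthogonal group with a given matrix. -/
def SOg.ofMat (r : Matrix (Fin N) (Fin N) ℝ) (h : rᵀ * r = 1) (hdet : r.det = 1) : SOg N :=
  ⟨⟨r, (Matrix.mem_orthogonalGroup_iff' (Fin N) ℝ).mpr h⟩, hdet⟩

lemma continuous_soMat : Continuous (soMat : SOg N → Matrix (Fin N) (Fin N) ℝ) :=
  continuous_subtype_val.comp continuous_subtype_val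

lemma isEmbedding_soMat :
    Topology.IsEmbedding (soMat : SOg N → Matrix (Fin N) (Fin N) ℝ) :=
  Topology.IsEmbedding.subtypeVal.comp Topology.IsEmbedding.subtypeVal

lemma range_soMat : Set.range (soMat : SOg N → Matrix (Fin N) (Fin N) ℝ) =
    {r | rᵀ * r = 1 ∧ r.det = 1} := by
  ext r
  constructor
  · rintro ⟨u, rfl⟩
    exact ⟨(soMat_transpose_mul u), soMat_det u⟩
  · rintro ⟨h, hdet⟩
    exact ⟨SOg.ofMat r h hdet, rfl⟩

instance SOg_compactSpace : CompactSpace (SOg N) := by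
  rw [← isCompact_univ_iff, isEmbedding_soMat.isCompact_iff, Set.image_univ, range_soMat]
  have hK : IsCompact (Set.univ.pi fun _ : Fin N => Set.univ.pi fun _ : Fin N =>
      Set.Icc (-1 : ℝ) 1) :=
    isCompact_univ_pi fun _ => isCompact_univ_pi fun _ => isCompact_Icc
  refine IsCompact.of_isClosed_subset (X := Matrix (Fin N) (Fin N) ℝ) hK ?_ ?_
  · have h1 : Continuous fun r : Matrix (Fin N) (Fin N) ℝ => rᵀ * r := by fun_prop
    have h2 : Continuous fun r : Matrix (Fin N) (Fin N) ℝ => r.det := by fun_prop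
    exact (isClosed_eq h1 continuous_const).inter (isClosed_eq h2 continuous_const)
  · rintro r ⟨hr, -⟩ i - j -
    have h1 := congrFun (congrFun hr j) j
    rw [Matrix.mul_apply, Matrix.one_apply_eq] at h1
    have h2 : r i j ^ 2 ≤ 1 := by
      rw [← h1]
      simp_rw [Matrix.transpose_apply, ← pow_two]
      exact Finset.single_le_sum (f := fun x => r x j ^ 2) (fun x _ => sq_nonneg _)
        (Finset.mem_univ i)
    exact abs_le.mp (sq_le_one_iff_abs_le_one _ |>.mp h2)

lemma SOg.integrable_of_continuous {E : Type*} [NormedAddCommGroup E]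
    [SecondCountableTopologyEither (SOg N) E]
    {μ : Measure (SOg N)} [IsFiniteMeasure μ] {f : SOg N → E} (hf : Continuous f) :
    Integrable f μ :=
  hf.integrable_of_hasCompactSupport (HasCompactSupport.of_compactSpace _)

lemma SOg.continuous_resolventPart {a : ℝ} (ha : a ∈ Set.Ioo (0 : ℝ) 1) (i j : Fin N) :
    Continuous fun u : SOg N => resolventPart (soMat u) a i j := by
  have h1 : Continuous fun u : SOg N => (1 - a • soMat u) :=
    continuous_const.sub (continuous_soMat.const_smul a)
  have h2 : Continuous fun u : SOg N => (1 - a • soMat u)⁻¹ := by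
    simp only [Matrix.inv_def, Ring.inverse_eq_inv']
    refine Continuous.smul (h1.matrix_det.inv₀ fun u => ?_) h1.matrix_adjugate
    exact det_one_sub_smul_ne_zero (soMat_transpose_mul u) ha
  exact (h2.sub continuous_const).matrix_elem i j

lemma SOg.integral_planeRotation {μ : Measure (SOg N)} [μ.IsHaarMeasure] [IsFiniteMeasure μ]
    {k : ℕ} {a : Fin k → ℝ}
    (ha : ∀ i, a i ∈ Set.Ioo (0 : ℝ) 1) {p q : Fin N} (hpq : p ≠ q) :
    ∫ u : SOg N, (∏ i, (1 - a i • soMat u).det) *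
      (∑ i, (resolventPart (soMat u) (a i) p p + resolventPart (soMat u) (a i) q q +
          2 * (resolventPart (soMat u) (a i) p p * resolventPart (soMat u) (a i) q q -
            resolventPart (soMat u) (a i) p q * resolventPart (soMat u) (a i) q p)) +
        ∑ i, ∑ l ∈ Finset.univ.erase i,
          (resolventPart (soMat u) (a i) q p - resolventPart (soMat u) (a i) p q) *
          (resolventPart (soMat u) (a l) q p - resolventPart (soMat u) (a l) p q)) ∂μ = 0 := by
  set x : Fin k → SOg N → ℝ := fun i u =>
    resolventPart (soMat u) (a i) p p + resolventPart (soMat u) (a i) q q +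
      2 * (resolventPart (soMat u) (a i) p p * resolventPart (soMat u) (a i) q q -
        resolventPart (soMat u) (a i) p q * resolventPart (soMat u) (a i) q p) with hx
  set y : Fin k → SOg N → ℝ := fun i u =>
    resolventPart (soMat u) (a i) q p - resolventPart (soMat u) (a i) p q with hy
  have hxc : ∀ i, Continuous (x i) := fun i => by
    have := fun p q : Fin N => SOg.continuous_resolventPart (ha i) p q
    exact ((this p p).add (this q q)).add
      ((((this p p).mul (this q q)).sub ((this p q).mul (this q p))).const_mul 2)
  have hyc : ∀ i, Continuous (y i) := fun i =>
    (SOg.continuous_resolventPart (ha i) q p).sub (SOg.continuous_resolventPart (ha i) p q)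
  set D : SOg N → ℝ := fun u => ∏ i, (1 - a i • soMat u).det with hD
  have hDc : Continuous D := continuous_finsetProd _ fun i _ =>
    (continuous_const.sub (continuous_soMat.const_smul (a i))).matrix_det
  set Q : SOg N → ℝ[X] := fun u =>
    ∏ i, (1 + C (-2 * y i u) * X + C (1 + 2 * x i u) * X ^ 2) with hQ
  have hQc : ContinuousCoeff Q := by
    refine ContinuousCoeff.prod fun i => ?_
    refine ContinuousCoeff.add (ContinuousCoeff.add (.const _) ?_) ?_
    · exact (ContinuousCoeff.C ((hyc i).const_mul _)).mul (.const _)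
    · exact (ContinuousCoeff.C (continuous_const.add ((hxc i).const_mul _))).mul (.const _)
  have hQd : ∀ u, (Q u).natDegree < k * 2 + 1 := by
    intro u
    refine Nat.lt_succ_of_le ((natDegree_prod_le _ _).trans ?_)
    refine (Finset.sum_le_card_nsmul _ _ 2 fun i _ => ?_).trans (by simp)
    compute_degree
  have hmain := integral_mul_coeff_eq (μ := μ) hDc hQc hQd
    (q := C (∫ u, D u ∂μ) * ∏ _i : Fin k, (1 + C 0 * X + C 1 * X ^ 2)) (fun h => by
      have hr := integral_mul_left_eq_self (μ := μ) D
        (SOg.ofMat (planeRotation p q h) (planeRotation_transpose_mul hpq h)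
          (planeRotation_det hpq h))
      rw [eval_mul, eval_C, ← hr, ← integral_mul_const]
      refine integral_congr_ae (ae_of_all _ fun u => ?_)
      simp only [hQ, hD, eval_prod, ← Finset.prod_mul_distrib]
      refine Finset.prod_congr rfl fun i _ => ?_
      have := det_one_sub_smul_planeRotation_mul
        (det_one_sub_smul_ne_zero (soMat_transpose_mul u) (ha i)) p q h
      rw [soMat_mul]
      simp only [eval_add, eval_mul, eval_C, eval_X, eval_pow, eval_one]
      change _ = (1 - a i • (planeRotation p q h * (soMat u))).det * _
      linear_combination -this) 2
  have h2 : ∀ u, D u * (∑ i, x i u + ∑ i, ∑ l ∈ Finset.univ.erase i, y i u * y l u) =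
      2⁻¹ * (D u * (Q u).coeff 2 - k * D u) := by
    intro u
    have := two_mul_coeff_two_prod_quadratic (fun i => -2 * y i u) (fun i => 1 + 2 * x i u)
    have e1 : ∑ i : Fin k, (1 + 2 * x i u) = k + 2 * ∑ i, x i u := by
      rw [Finset.sum_add_distrib, ← Finset.mul_sum]; simp
    have e2 : ∑ i, ∑ l ∈ Finset.univ.erase i, -2 * y i u * (-2 * y l u) =
        4 * ∑ i, ∑ l ∈ Finset.univ.erase i, y i u * y l u := by
      simp_rw [Finset.mul_sum]
      exact Finset.sum_congr rfl fun i _ => Finset.sum_congr rfl fun l _ => by ring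
    rw [e1, e2] at this
    simp only [hQ]
    linear_combination -(D u / 4) * this
  have h3 : 2 * (∏ _i : Fin k, (1 + C 0 * X + C 1 * X ^ 2 : ℝ[X])).coeff 2 = 2 * k := by
    rw [two_mul_coeff_two_prod_quadratic (fun _ : Fin k => 0) (fun _ => 1)]
    simp
  change ∫ u, D u * (∑ i, x i u + ∑ i, ∑ l ∈ Finset.univ.erase i, y i u * y l u) ∂μ = 0
  simp_rw [h2]
  have i1 : Integrable (fun u => D u * (Q u).coeff 2) μ :=
    SOg.integrable_of_continuous (hDc.mul (hQc 2))
  have i2 : Integrable (fun u => k * D u) μ := SOg.integrable_of_continuous (hDc.const_mul _)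
  rw [integral_const_mul, integral_sub i1 i2, hmain, integral_const_mul, coeff_C_mul]
  linear_combination (∫ u, D u ∂μ) / 4 * h3

end SpecialOrthogonalGroup

section PlaneSums

variable {n : Type*} [Fintype n] [DecidableEq n]

lemma sum_sum_erase_minor (R : Matrix n n ℝ) :
    ∑ p, ∑ q ∈ Finset.univ.erase p, (R p p + R q q + 2 * (R p p * R q q - R p q * R q p)) =
      2 * ((Fintype.card n - 1 : ℝ) * R.trace + R.trace ^ 2 - (R * R).trace) := by
  have h1 : ∀ p, ∑ q ∈ Finset.univ.erase p,
      (R p p + R q q + 2 * (R p p * R q q - R p q * R q p)) =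
      ∑ q, (R p p + R q q + 2 * (R p p * R q q - R p q * R q p)) - 2 * R p p := by
    intro p
    rw [← Finset.sum_erase_add _ _ (Finset.mem_univ p)]
    ring
  have h2 : (R * R).trace = ∑ p, ∑ q, R p q * R q p := by
    simp [Matrix.trace, Matrix.mul_apply]
  have h3 : R.trace ^ 2 = ∑ p, ∑ q, R p p * R q q := by
    rw [pow_two, Matrix.trace, Finset.sum_mul_sum]; rfl
  have h4 : R.trace = ∑ p, R p p := rfl
  simp_rw [h1, Finset.sum_sub_distrib, Finset.sum_add_distrib, ← Finset.mul_sum,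
    Finset.sum_sub_distrib]
  rw [h2, h3, ← h4]
  simp only [Finset.sum_const, Finset.card_univ, nsmul_eq_mul, ← Finset.mul_sum, ← h4]
  ring

lemma sum_sum_erase_skew (R S : Matrix n n ℝ) :
    ∑ p, ∑ q ∈ Finset.univ.erase p, (R q p - R p q) * (S q p - S p q) =
      2 * ((R * Sᵀ).trace - (R * S).trace) := by
  have h1 : ∀ p, ∑ q ∈ Finset.univ.erase p, (R q p - R p q) * (S q p - S p q) =
      ∑ q, (R q p - R p q) * (S q p - S p q) := fun p =>
    Finset.sum_erase _ (by ring)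
  have h2 : (R * Sᵀ).trace = ∑ p, ∑ q, R p q * S p q := by
    simp [Matrix.trace, Matrix.mul_apply]
  have h3 : (R * S).trace = ∑ p, ∑ q, R p q * S q p := by
    simp [Matrix.trace, Matrix.mul_apply]
  have h4 : ∑ p, ∑ q, R q p * S q p = ∑ p, ∑ q, R p q * S p q := Finset.sum_comm
  have h5 : ∑ p, ∑ q, R q p * S p q = ∑ p, ∑ q, R p q * S q p := Finset.sum_comm
  simp_rw [h1, sub_mul, mul_sub, Finset.sum_sub_distrib]
  rw [h2, h3, h4, h5]
  ring

lemma sum_sum_erase_minor_add_skew {k : ℕ} (R : Fin k → Matrix n n ℝ) :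
    ∑ p, ∑ q ∈ Finset.univ.erase p,
      (∑ i, (R i p p + R i q q + 2 * (R i p p * R i q q - R i p q * R i q p)) +
        ∑ i, ∑ l ∈ Finset.univ.erase i, (R i q p - R i p q) * (R l q p - R l p q)) =
    2 * (∑ i, ((Fintype.card n - 1 : ℝ) * (R i).trace + (R i).trace ^ 2 - (R i * R i).trace) +
      ∑ i, ∑ l ∈ Finset.univ.erase i, ((R i * (R l)ᵀ).trace - (R i * R l).trace)) := by
  have hswap : ∀ (T : Finset (Fin k)) (f : Fin k → n → n → ℝ),
      ∑ p, ∑ q ∈ Finset.univ.erase p, ∑ i ∈ T, f i p q =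
        ∑ i ∈ T, ∑ p, ∑ q ∈ Finset.univ.erase p, f i p q := by
    intro T f
    conv_rhs => rw [Finset.sum_comm]
    exact Finset.sum_congr rfl fun p _ => Finset.sum_comm
  rw [Finset.sum_congr rfl fun p _ => Finset.sum_add_distrib, Finset.sum_add_distrib, hswap,
    hswap, mul_add, Finset.mul_sum, Finset.mul_sum]
  congr 1
  · exact Finset.sum_congr rfl fun i _ => sum_sum_erase_minor (R i)
  · refine Finset.sum_congr rfl fun i _ => ?_
    rw [hswap, Finset.mul_sum]
    exact Finset.sum_congr rfl fun l _ => sum_sum_erase_skew (R i) (R l)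

end PlaneSums

section Coordinates

variable {N : ℕ}

lemma continuousCoeff_charpolyRev :
    ContinuousCoeff fun u : SOg N => (soMat u).charpolyRev := by
  have h : ∀ u : SOg N, (soMat u).charpolyRev = ∑ σ : Equiv.Perm (Fin N),
      C (((Equiv.Perm.sign σ : ℤ) : ℝ)) * ∏ i, (C ((1 : Matrix (Fin N) (Fin N) ℝ) (σ i) i) +
        C (-soMat u (σ i) i) * X) := by
    intro u
    rw [Matrix.charpolyRev, Matrix.det_apply']
    refine Finset.sum_congr rfl fun σ _ => ?_
    congr 1
    refine Finset.prod_congr rfl fun i _ => ?_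
    by_cases h : σ i = i <;>
      simp [Matrix.one_apply, Matrix.smul_apply, sub_eq_add_neg, mul_comm X, h]
  simp_rw [h]
  refine ContinuousCoeff.sum fun σ => (ContinuousCoeff.const _).mul (.prod fun i => ?_)
  refine (ContinuousCoeff.const _).add ((ContinuousCoeff.C ?_).mul (.const _))
  exact (continuous_soMat.matrix_elem _ _).neg

/-- The polynomial `χ` with `det (1 - z u) = (1 - z) z ^ m χ(z + z⁻¹)`. -/
noncomputable def soPoly {m : ℕ} (u : SOg (2 * m + 1)) : ℝ[X] := halvedPoly m (soMat u).charpolyRev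

variable {m k : ℕ}

lemma soPoly_monic (u : SOg (2 * m + 1)) : (soPoly u).Monic :=
  (halvedPoly_monic_natDegree (coeff_zero_charpolyRev _)).1

lemma natDegree_soPoly (u : SOg (2 * m + 1)) : (soPoly u).natDegree = m :=
  (halvedPoly_monic_natDegree (coeff_zero_charpolyRev _)).2

lemma continuous_wedgeCoord_soPoly {n : ℕ} (r : Fin k → Fin n) :
    Continuous fun u : SOg (2 * m + 1) => wedgeCoord (soPoly u) r := by
  unfold wedgeCoord
  refine Continuous.matrix_det (continuous_matrix fun i s => ?_)
  have h : ∀ u : SOg (2 * m + 1), chebWBasis.repr (chebW ℝ s * soPoly u) (r i) =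
      ∑ t ∈ Finset.range (m + 1), (soMat u).charpolyRev.coeff t *
        chebWBasis.repr (chebW ℝ s * chebW ℝ (m - t)) (r i) := by
    intro u
    rw [soPoly, halvedPoly, Finset.mul_sum, map_sum, Finsupp.finsetSum_apply]
    refine Finset.sum_congr rfl fun t _ => ?_
    rw [mul_left_comm, ← smul_eq_C_mul, map_smul, Finsupp.smul_apply, smul_eq_mul]
  simp only [Matrix.of_apply, h]
  exact continuous_finsetSum _ fun t _ => (continuousCoeff_charpolyRev t).mul_const _

lemma det_one_sub_smul_soMat (u : SOg (2 * m + 1)) {a : ℝ} (ha : a ≠ 0) :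
    (1 - a • soMat u).det = (1 - a) * a ^ m * (soPoly u).eval (a + a⁻¹) := by
  rw [← eval_charpolyRev_real, soPoly,
    eval_charpolyRev_eq_mul_eval_halvedPoly (soMat_transpose_mul u) (soMat_det u) ha]

variable {μ : Measure (SOg (2 * m + 1))} [μ.IsHaarMeasure] [IsProbabilityMeasure μ]

lemma integral_prod_eval_soPoly_mul_eq_zero {a : Fin k → ℝ} (ha : ∀ i, a i ∈ Set.Ioo (0 : ℝ) 1) :
    ∫ u, (∏ i, (soPoly u).eval (a i + (a i)⁻¹)) *
      (∑ i, (2 * m * (resolventPart (soMat u) (a i)).trace +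
          (resolventPart (soMat u) (a i)).trace ^ 2 -
          (resolventPart (soMat u) (a i) * resolventPart (soMat u) (a i)).trace) +
        ∑ i, ∑ l ∈ Finset.univ.erase i,
          ((resolventPart (soMat u) (a i) * (resolventPart (soMat u) (a l))ᵀ).trace -
            (resolventPart (soMat u) (a i) * resolventPart (soMat u) (a l)).trace)) ∂μ = 0 := by
  have hsum : ∑ p : Fin (2 * m + 1), ∑ q ∈ Finset.univ.erase p,
      ∫ u, (∏ i, (1 - a i • soMat u).det) *
      (∑ i, (resolventPart (soMat u) (a i) p p + resolventPart (soMat u) (a i) q q +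
          2 * (resolventPart (soMat u) (a i) p p * resolventPart (soMat u) (a i) q q -
            resolventPart (soMat u) (a i) p q * resolventPart (soMat u) (a i) q p)) +
        ∑ i, ∑ l ∈ Finset.univ.erase i,
          (resolventPart (soMat u) (a i) q p - resolventPart (soMat u) (a i) p q) *
          (resolventPart (soMat u) (a l) q p - resolventPart (soMat u) (a l) p q)) ∂μ = 0 :=
    Finset.sum_eq_zero fun p _ => Finset.sum_eq_zero fun q hq =>
      SOg.integral_planeRotation ha (Finset.ne_of_mem_erase hq).symm
  have hR := fun i (p q : Fin (2 * m + 1)) => SOg.continuous_resolventPart (ha i) p q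
  have hD : Continuous fun u : SOg (2 * m + 1) => ∏ i, (1 - a i • soMat u).det :=
    continuous_finsetProd _ fun i _ =>
      (continuous_const.sub (continuous_soMat.const_smul (a i))).matrix_det
  have hint : ∀ p q : Fin (2 * m + 1), Integrable (fun u => (∏ i, (1 - a i • soMat u).det) *
      (∑ i, (resolventPart (soMat u) (a i) p p + resolventPart (soMat u) (a i) q q +
          2 * (resolventPart (soMat u) (a i) p p * resolventPart (soMat u) (a i) q q -
            resolventPart (soMat u) (a i) p q * resolventPart (soMat u) (a i) q p)) +
        ∑ i, ∑ l ∈ Finset.univ.erase i,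
          (resolventPart (soMat u) (a i) q p - resolventPart (soMat u) (a i) p q) *
          (resolventPart (soMat u) (a l) q p - resolventPart (soMat u) (a l) p q))) μ := by
    intro p q
    refine SOg.integrable_of_continuous (hD.mul ?_)
    refine (continuous_finsetSum _ fun i _ => ?_).add
      (continuous_finsetSum _ fun i _ => continuous_finsetSum _ fun l _ => ?_)
    · exact ((hR i p p).add (hR i q q)).add
        ((((hR i p p).mul (hR i q q)).sub ((hR i p q).mul (hR i q p))).const_mul 2)
    · exact ((hR i q p).sub (hR i p q)).mul ((hR l q p).sub (hR l p q))
  rw [Finset.sum_congr rfl fun p _ => (integral_finsetSum _ fun q _ => hint p q).symm,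
    ← integral_finsetSum _ fun p _ => integrable_finsetSum _ fun q _ => hint p q] at hsum
  have hc : (∏ i, (1 - a i)) * (∏ i, a i ^ m) * 2 ≠ 0 := by
    refine mul_ne_zero (mul_ne_zero ?_ ?_) two_ne_zero
    · exact Finset.prod_ne_zero_iff.mpr fun i _ => sub_ne_zero.mpr (ha i).2.ne'
    · exact Finset.prod_ne_zero_iff.mpr fun i _ => pow_ne_zero _ (ha i).1.ne'
  refine (mul_eq_zero.mp (?_ : ((∏ i, (1 - a i)) * (∏ i, a i ^ m) * 2) * _ = 0)).resolve_left hc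
  rw [← integral_const_mul, ← hsum]
  refine integral_congr_ae (ae_of_all _ fun u => ?_)
  have h := sum_sum_erase_minor_add_skew fun i => resolventPart (soMat u) (a i)
  simp only [Fintype.card_fin, Nat.cast_add, Nat.cast_mul, Nat.cast_ofNat, Nat.cast_one,
    add_sub_cancel_right] at h
  simp only [← Finset.mul_sum (a := ∏ i, (1 - a i • soMat u).det)]
  rw [h]
  simp only [det_one_sub_smul_soMat u (ha _).1.ne', Finset.prod_mul_distrib]
  ring

lemma eigenvalue_sub_mul_integral_wedgeCoord (r : Fin k → Fin (m + k)) :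
    (∑ i, ((r i : ℕ) : ℝ) * ((r i : ℕ) + 1) - ∑ s : Fin k, ((m : ℝ) + s) * (m + s + 1)) *
      ∫ u, wedgeCoord (soPoly u) r ∂μ = 0 := by
  refine eq_zero_of_sum_mul_prod_eval_eq_zero (x := fun r : Fin k → Fin (m + k) =>
    (∑ i, ((r i : ℕ) : ℝ) * ((r i : ℕ) + 1) - ∑ s : Fin k, ((m : ℝ) + s) * (m + s + 1)) *
      ∫ u, wedgeCoord (soPoly u) r ∂μ) (fun a hinj ha => ?_) r
  have hA : Function.Injective fun i => a i + (a i)⁻¹ := fun i j hij =>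
    hinj (add_inv_injOn (ha i) (ha j) hij)
  have h1 := integral_prod_eval_soPoly_mul_eq_zero (μ := μ) ha
  have h2 : ∀ u : SOg (2 * m + 1), _ := fun u =>
    sum_eigenvalue_sub_mul_wedgeCoord (natDegree_soPoly u) (soPoly_monic u) hA
      (fun i => halvedPoly_charpolyRev_eval_ne_zero (soMat_transpose_mul u) (soMat_det u) (ha i))
  have h3 : ∀ (u : SOg (2 * m + 1)) i, _ := fun u i =>
    jacobiOp_halvedPoly_charpolyRev_div (soMat_transpose_mul u) (soMat_det u) (ha i)
  have h4 : ∀ (u : SOg (2 * m + 1)) i, ∀ l ∈ Finset.univ.erase i, _ := fun u i l hl =>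
    divided_difference_halvedPoly_charpolyRev (soMat_transpose_mul u) (soMat_det u) (ha i) (ha l)
      (fun h => Finset.ne_of_mem_erase hl (hinj h).symm)
  have h5 : ∀ u : SOg (2 * m + 1), ∑ r : Fin k → Fin (m + k),
      (∑ i, ((r i : ℕ) : ℝ) * ((r i : ℕ) + 1) - ∑ s : Fin k, ((m : ℝ) + s) * (m + s + 1)) *
        ((∏ i, (chebW ℝ (r i)).eval (a i + (a i)⁻¹)) * wedgeCoord (soPoly u) r) =
      (chebWMatrix fun i => a i + (a i)⁻¹).det * ((∏ i, (soPoly u).eval (a i + (a i)⁻¹)) *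
      (∑ i, (2 * m * (resolventPart (soMat u) (a i)).trace +
          (resolventPart (soMat u) (a i)).trace ^ 2 -
          (resolventPart (soMat u) (a i) * resolventPart (soMat u) (a i)).trace) +
        ∑ i, ∑ l ∈ Finset.univ.erase i,
          ((resolventPart (soMat u) (a i) * (resolventPart (soMat u) (a l))ᵀ).trace -
            (resolventPart (soMat u) (a i) * resolventPart (soMat u) (a l)).trace))) := by
    intro u
    rw [h2 u, Finset.sum_congr rfl fun i _ => (h3 u i).symm,
      Finset.sum_congr rfl fun i _ => Finset.sum_congr rfl fun l hl => (h4 u i l hl).symm]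
    simp only [soPoly]
    ring
  have hint : ∀ r : Fin k → Fin (m + k), Integrable (fun u =>
      (∑ i, ((r i : ℕ) : ℝ) * ((r i : ℕ) + 1) - ∑ s : Fin k, ((m : ℝ) + s) * (m + s + 1)) *
        ((∏ i, (chebW ℝ (r i)).eval (a i + (a i)⁻¹)) * wedgeCoord (soPoly u) r)) μ := fun r =>
    SOg.integrable_of_continuous (((continuous_wedgeCoord_soPoly r).const_mul _).const_mul _)
  have h6 := integral_congr_ae (μ := μ) (ae_of_all _ h5)
  rw [integral_const_mul, h1, mul_zero, integral_finsetSum _ fun r _ => hint r] at h6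
  rw [← h6]
  refine Finset.sum_congr rfl fun r _ => ?_
  rw [integral_const_mul, integral_const_mul]
  ring

lemma integral_wedgeCoord_soPoly (r : Fin k → Fin (m + k)) :
    ∫ u, wedgeCoord (soPoly u) r ∂μ = topCoord r := by
  by_cases h : ∀ i, m ≤ (r i : ℕ)
  · simp_rw [fun u => wedgeCoord_eq_topCoord (natDegree_soPoly u) (soPoly_monic u) h]
    simp
  · push Not at h
    obtain ⟨i, hi⟩ := h
    rw [topCoord_eq_zero hi]
    by_cases hr : Function.Injective r
    · exact (mul_eq_zero.mp (eigenvalue_sub_mul_integral_wedgeCoord r)).resolve_left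
        (sub_ne_zero.mpr (sum_eigenvalue_lt hr hi).ne)
    · simp_rw [fun u => wedgeCoord_eq_zero_of_not_injective (soPoly u) hr]
      simp

lemma det_chebWMatrix_mul_integral_prod_aeval (A : Fin k → ℂ) :
    (chebWMatrix A).det * ∫ u, ∏ i, aeval (A i) (soPoly u) ∂μ =
      (Matrix.of fun i s : Fin k => (chebW ℂ (m + s)).eval (A i)).det := by
  rw [← sum_prod_eval_mul_topCoord, ← integral_const_mul]
  simp_rw [mul_comm (chebWMatrix A).det]
  simp_rw [fun u => (sum_prod_eval_mul_wedgeCoord (natDegree_soPoly u) (soPoly_monic u) A).symm]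
  have hint : ∀ r : Fin k → Fin (m + k), Integrable (fun u : SOg (2 * m + 1) =>
      (∏ i, (chebW ℂ (r i)).eval (A i)) * algebraMap ℝ ℂ (wedgeCoord (soPoly u) r)) μ := fun r =>
    SOg.integrable_of_continuous
      ((Complex.continuous_ofReal.comp (continuous_wedgeCoord_soPoly r)).const_mul _)
  rw [integral_finsetSum _ fun r _ => hint r]
  refine Finset.sum_congr rfl fun r _ => ?_
  rw [integral_const_mul, ← integral_wedgeCoord_soPoly (μ := μ) r]
  congr 1
  exact integral_ofReal

lemma det_one_sub_smul_toC (u : SOg (2 * m + 1)) {z : ℂ} (hz : z ≠ 0) :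
    (1 - z • toC (u : Matrix.orthogonalGroup (Fin (2 * m + 1)) ℝ)).det =
      (1 - z) * z ^ m * aeval (z + z⁻¹) (soPoly u) := by
  rw [soPoly, ← aeval_eq_mul_aeval_halvedPoly
    (natDegree_charpolyRev_le (soMat_transpose_mul u) (soMat_det u))
    (coeff_charpolyRev_antipalindromic (soMat_transpose_mul u) (soMat_det u)) hz,
    aeval_charpolyRev]
  rfl

lemma det_chebWMatrix_mul_integral_prod_det {a : Fin k → ℂ} (ha : ∀ i, a i ≠ 0) :
    (chebWMatrix fun i => a i + (a i)⁻¹).det * ∫ u : SOg (2 * m + 1),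
        ∏ i, (1 - a i • toC (u : Matrix.orthogonalGroup (Fin (2 * m + 1)) ℝ)).det ∂μ =
      (∏ i, (1 - a i) * a i ^ m) *
        (Matrix.of fun i s : Fin k => (chebW ℂ (m + s)).eval (a i + (a i)⁻¹)).det := by
  simp_rw [fun u i => det_one_sub_smul_toC u (ha i), Finset.prod_mul_distrib (f := fun i =>
    (1 - a i) * a i ^ m)]
  rw [integral_const_mul, ← det_chebWMatrix_mul_integral_prod_aeval (μ := μ)]
  ring

end Coordinates

section Christoffel

lemma sign_finAddFlip (m k : ℕ) :
    Equiv.Perm.sign ((finAddFlip (m := m) (n := k)).trans (finCongr (add_comm k m))) =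
      (-1) ^ (k * m) := by
  have h : (finAddFlip (m := m) (n := k)).trans (finCongr (add_comm k m)) =
      finRotate (m + k) ^ k := by
    rcases Nat.eq_zero_or_pos (m + k) with h0 | h0
    · ext i; exact absurd i.2 (by lia)
    · obtain ⟨n, hn⟩ : ∃ n, m + k = n + 1 := ⟨m + k - 1, by lia⟩
      have hpow : ∀ (l : ℕ) (i : Fin (m + k)), ((finRotate (m + k) ^ l) i : ℕ) =
          (i + l) % (m + k) := by
        rw [hn]
        intro l i
        induction l with
        | zero => simp [Nat.mod_eq_of_lt i.2]
        | succ l ih =>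
          rw [pow_succ', Equiv.Perm.mul_apply, finRotate_apply, Fin.val_add, ih]
          simp [add_assoc]
      ext i
      rw [hpow]
      simp only [Equiv.trans_apply, finCongr_apply, Fin.val_cast]
      rcases lt_or_ge (i : ℕ) m with hi | hi
      · rw [show i = ⟨i, i.2⟩ from rfl, finAddFlip_apply_mk_left hi, Nat.mod_eq_of_lt (by
          change (i : ℕ) + k < _; lia)]
        exact add_comm _ _
      · rw [show i = ⟨i, i.2⟩ from rfl, finAddFlip_apply_mk_right hi i.2]
        change (i : ℕ) - m = ((i : ℕ) + k) % (m + k)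
        rw [show (i : ℕ) + k = (i - m) + (m + k) by lia, Nat.add_mod_right, Nat.mod_eq_of_lt
          (by lia)]
  rw [h, map_pow, sign_finRotate, ← pow_mul]
  rcases Nat.eq_zero_or_pos k with rfl | hk
  · simp
  · rw [show (m + k - 1) * k = k * m + (k - 1) * k by
      obtain ⟨l, rfl⟩ : ∃ l, k = l + 1 := ⟨k - 1, by lia⟩
      simp only [Nat.add_sub_cancel, ← add_assoc]; ring, pow_add]
    have : Even ((k - 1) * k) := by
      obtain ⟨l, rfl⟩ : ∃ l, k = l + 1 := ⟨k - 1, by lia⟩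
      exact Nat.even_mul_succ_self l
    rw [this.neg_one_pow, mul_one]

variable {R : Type*} [CommRing R]

lemma det_functional_monic_eq {n : ℕ} (ℓ : Fin n → R[X] →ₗ[R] R) (p : Fin n → R[X])
    (hdeg : ∀ j, (p j).natDegree = j) (hp : ∀ j, (p j).Monic) :
    (Matrix.of fun i j : Fin n => ℓ i (p j)).det =
      (Matrix.of fun i j : Fin n => ℓ i (X ^ (j : ℕ))).det := by
  have h : (Matrix.of fun i j : Fin n => ℓ i (p j)) =
      (Matrix.of fun i j : Fin n => ℓ i (X ^ (j : ℕ))) *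
        Matrix.of fun i j : Fin n => (p j).coeff i := by
    ext i j
    rw [Matrix.mul_apply, Matrix.of_apply]
    conv_lhs => rw [(p j).as_sum_range_C_mul_X_pow' (n := n) (by rw [hdeg]; exact j.2), map_sum,
      ← Fin.sum_univ_eq_sum_range (fun t => ℓ i (C ((p j).coeff t) * X ^ t))]
    refine Finset.sum_congr rfl fun t _ => ?_
    rw [← smul_eq_C_mul, map_smul, smul_eq_mul, Matrix.of_apply, Matrix.of_apply, mul_comm]
  rw [h, Matrix.det_mul, Matrix.det_matrixOfPolynomials p hdeg hp, mul_one]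

/-- Christoffel's formula for the Gram determinant of a functional multiplied by a polynomial. -/
lemma det_gram_mul_det_chebWMatrix [Nontrivial R] {m k : ℕ} (I : R[X] →ₗ[R] R)
    (hI : ∀ i j : ℕ, I (chebW R i * chebW R j) = if i = j then 1 else 0) (A : Fin k → R) :
    (-1) ^ (k * m) * (Matrix.of fun i j : Fin m =>
        I ((∏ l, (X - C (A l))) * (chebW R i * chebW R j))).det * (chebWMatrix A).det =
      (Matrix.of fun i s : Fin k => (chebW R (m + s)).eval (A i)).det := by
  set ℓ : Fin m ⊕ Fin k → R[X] →ₗ[R] R :=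
    Sum.elim (fun i => I ∘ₗ LinearMap.mulLeft R (chebW R i)) (fun i => leval (A i)) with hℓ
  set P : R[X] := ∏ l, (X - C (A l)) with hP
  have hPm : P.Monic := monic_prod_of_monic _ _ fun l _ => monic_X_sub_C _
  have hPd : P.natDegree = k := by
    rw [hP, natDegree_prod_of_monic _ _ fun l _ => monic_X_sub_C _]; simp
  set q : Fin (m + k) → R[X] := fun r =>
    if (r : ℕ) < k then chebW R r else chebW R (r - k) * P with hq
  set e : Fin m ⊕ Fin k ≃ Fin (m + k) := finSumFinEquiv with he
  have h1 := det_functional_monic_eq (fun t => ℓ (e.symm t)) (fun r => chebW R r)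
    (fun r => natDegree_chebW _) (fun r => chebW_monic _)
  have h2 := det_functional_monic_eq (fun t => ℓ (e.symm t)) q
    (fun r => by
      simp only [hq]
      split_ifs with h
      · exact natDegree_chebW _
      · rw [(chebW_monic _).natDegree_mul hPm, natDegree_chebW, hPd]; lia)
    (fun r => by
      simp only [hq]
      split_ifs with h
      · exact chebW_monic _
      · exact (chebW_monic _).mul hPm)
  set σ : Equiv.Perm (Fin (m + k)) :=
    (finAddFlip (m := m) (n := k)).trans (finCongr (add_comm k m)) with hσ
  have h3 : (Matrix.of fun t r : Fin (m + k) => ℓ (e.symm t) (chebW R r)).submatrix e e =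
      fromBlocks 1 0 (Matrix.of fun i j : Fin _ => (chebW R j).eval (A i))
        (Matrix.of fun i s : Fin k => (chebW R (m + s)).eval (A i)) := by
    ext i j
    rcases i with i | i <;> rcases j with j | j
    · simp [hℓ, he, hI, Matrix.one_apply, Fin.ext_iff]
    · have : (i : ℕ) ≠ m + j := by lia
      simp [hℓ, he, hI, this]
    · simp [hℓ, he]
    · simp [hℓ, he]
  have h4 : ((Matrix.of fun t r : Fin (m + k) => ℓ (e.symm t) (q r)).submatrix id σ).submatrix e e =
      fromBlocks (Matrix.of fun i j : Fin m => I (P * (chebW R i * chebW R j)))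
        (Matrix.of fun (i : Fin m) (s : Fin k) => I (chebW R i * chebW R s)) 0
        (chebWMatrix A) := by
    have hP0 : ∀ i, P.eval (A i) = 0 := fun i => by
      rw [hP, eval_prod]
      exact Finset.prod_eq_zero (Finset.mem_univ i) (by simp)
    have hql : ∀ j : Fin m, q (σ (Fin.castAdd k j)) = chebW R j * P := fun j => by
      simp [hq, hσ]
    have hqr : ∀ s : Fin k, q (σ (Fin.natAdd m s)) = chebW R s := fun s => by
      simp [hq, hσ]
    ext i j
    rcases i with i | i <;> rcases j with j | j
    · simp [hℓ, he, hql, mul_comm P, mul_assoc]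
    · simp [hℓ, he, hqr]
    · simp [hℓ, he, hql, hP0]
    · simp [hℓ, he, hqr, chebWMatrix]
  have h5 := congrArg Matrix.det h3
  have h6 := congrArg Matrix.det h4
  rw [Matrix.det_submatrix_equiv_self, Matrix.det_fromBlocks_zero₁₂, Matrix.det_one, one_mul] at h5
  rw [Matrix.det_submatrix_equiv_self, Matrix.det_permute', Matrix.det_fromBlocks_zero₂₁,
    sign_finAddFlip] at h6
  rw [← h5, h1, ← h2, mul_assoc, ← h6, ← mul_assoc]
  push_cast
  rw [← pow_add, ← two_mul, pow_mul, neg_one_sq, one_pow, one_mul]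

end Christoffel

section FourierCoefficients

/-- The integral of `f(z + z⁻¹) (1 - z) (1 - z⁻¹) / 2` over the unit circle. -/
noncomputable def circleFunctional : ℂ[X] →ₗ[ℂ] ℂ where
  toFun f := ((2 * Real.pi : ℝ) : ℂ)⁻¹ * ∫ θ in (0 : ℝ)..(2 * Real.pi),
    f.eval (Complex.exp (Complex.I * θ) + (Complex.exp (Complex.I * θ))⁻¹) *
      ((1 - Complex.exp (Complex.I * θ)) * (1 - (Complex.exp (Complex.I * θ))⁻¹) / 2)
  map_add' f g := by
    have hc : ∀ f : ℂ[X], IntervalIntegrable (fun θ : ℝ =>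
        f.eval (Complex.exp (Complex.I * θ) + (Complex.exp (Complex.I * θ))⁻¹) *
          ((1 - Complex.exp (Complex.I * θ)) * (1 - (Complex.exp (Complex.I * θ))⁻¹) / 2))
        volume 0 (2 * Real.pi) := fun f => by
      refine Continuous.intervalIntegrable ?_ _ _
      simp_rw [← Complex.exp_neg]
      fun_prop
    simp_rw [eval_add, add_mul]
    rw [intervalIntegral.integral_add (hc f) (hc g), mul_add]
  map_smul' c f := by
    simp_rw [eval_smul, smul_eq_mul, mul_assoc]
    rw [intervalIntegral.integral_const_mul, RingHom.id_apply, mul_left_comm]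

lemma fCoeff_eq (f : ℝ → ℂ) (n : ℤ) :
    fCoeff f n = ((2 * Real.pi : ℝ) : ℂ)⁻¹ * ∫ θ in (0 : ℝ)..(2 * Real.pi),
      f θ * Complex.exp (Complex.I * θ) ^ (-n) := by
  simp_rw [fCoeff, ← Complex.exp_int_mul]
  push_cast
  simp_rw [mul_assoc]

lemma exp_I_mul_two_pi_sub (θ : ℝ) :
    Complex.exp (Complex.I * ((2 * Real.pi - θ : ℝ) : ℂ)) = (Complex.exp (Complex.I * θ))⁻¹ := by
  rw [← Complex.exp_neg, ← Complex.exp_periodic (-(Complex.I * θ))]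
  congr 1
  push_cast
  ring

lemma fCoeff_neg {f : ℝ → ℂ} (hf : ∀ θ, f (2 * Real.pi - θ) = f θ) (n : ℤ) :
    fCoeff f (-n) = fCoeff f n := by
  rw [fCoeff_eq, fCoeff_eq]
  congr 1
  have h := intervalIntegral.integral_comp_sub_left (a := 0) (b := 2 * Real.pi)
    (fun θ : ℝ => f θ * Complex.exp (Complex.I * θ) ^ (-n)) (2 * Real.pi)
  rw [sub_self, sub_zero] at h
  rw [← h]
  refine intervalIntegral.integral_congr fun θ _ => ?_
  simp only [hf, exp_I_mul_two_pi_sub, _root_.inv_zpow', neg_neg]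

lemma circleFunctional_mul_chebW_mul_chebW (F : ℂ[X]) (i j : ℕ) :
    circleFunctional (F * (chebW ℂ i * chebW ℂ j)) =
      fCoeff (fun θ => F.eval (Complex.exp (Complex.I * θ) + (Complex.exp (Complex.I * θ))⁻¹))
        ((i : ℤ) - j) -
      fCoeff (fun θ => F.eval (Complex.exp (Complex.I * θ) + (Complex.exp (Complex.I * θ))⁻¹))
        ((i : ℤ) + j + 1) := by
  set f : ℝ → ℂ := fun θ =>
    F.eval (Complex.exp (Complex.I * θ) + (Complex.exp (Complex.I * θ))⁻¹) with hf
  have hfe : ∀ θ, f (2 * Real.pi - θ) = f θ := by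
    intro θ
    simp only [hf, exp_I_mul_two_pi_sub, inv_inv, add_comm]
  have hfc : Continuous f := by
    simp only [hf, ← Complex.exp_neg]
    fun_prop
  have hi : ∀ n : ℤ, IntervalIntegrable (fun θ : ℝ => f θ * Complex.exp (Complex.I * θ) ^ n)
      volume 0 (2 * Real.pi) := fun n => by
    refine Continuous.intervalIntegrable ?_ _ _
    simp_rw [← Complex.exp_int_mul]
    fun_prop
  have hz : ∀ θ : ℝ, (F * (chebW ℂ i * chebW ℂ j)).eval
      (Complex.exp (Complex.I * θ) + (Complex.exp (Complex.I * θ))⁻¹) *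
      ((1 - Complex.exp (Complex.I * θ)) * (1 - (Complex.exp (Complex.I * θ))⁻¹) / 2) =
      2⁻¹ * ((f θ * Complex.exp (Complex.I * θ) ^ (-((i : ℤ) - j)) +
        f θ * Complex.exp (Complex.I * θ) ^ (-(-((i : ℤ) - j)))) -
        (f θ * Complex.exp (Complex.I * θ) ^ (-((i : ℤ) + j + 1)) +
        f θ * Complex.exp (Complex.I * θ) ^ (-(-((i : ℤ) + j + 1))))) := by
    intro θ
    have h0 : Complex.exp (Complex.I * θ) ≠ 0 := Complex.exp_ne_zero _
    simp only [hf]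
    generalize Complex.exp (Complex.I * θ) = z at *
    have h1 := one_sub_mul_pow_mul_eval_chebW h0 i
    have h2 := one_sub_mul_pow_mul_eval_chebW (inv_ne_zero h0) j
    rw [inv_inv, add_comm z⁻¹] at h2
    have h3 : (1 - z) * (1 - z⁻¹) * ((chebW ℂ i).eval (z + z⁻¹) * (chebW ℂ j).eval (z + z⁻¹)) =
        (z ^ i)⁻¹ * z ^ j * ((1 - z ^ (2 * i + 1)) * (1 - z⁻¹ ^ (2 * j + 1))) := by
      rw [← h1, ← h2, inv_pow]
      field_simp
    have h4 : (z ^ i)⁻¹ * z ^ j * ((1 - z ^ (2 * i + 1)) * (1 - z⁻¹ ^ (2 * j + 1))) =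
        (z ^ (-((i : ℤ) - j)) + z ^ (-(-((i : ℤ) - j)))) -
          (z ^ (-((i : ℤ) + j + 1)) + z ^ (-(-((i : ℤ) + j + 1)))) := by
      simp only [neg_neg, _root_.zpow_neg, zpow_sub₀ h0, zpow_add₀ h0, zpow_natCast, zpow_one, inv_pow]
      field_simp
      ring
    rw [eval_mul, eval_mul]
    linear_combination (F.eval (z + z⁻¹) / 2) * (h3.trans h4)
  change ((2 * Real.pi : ℝ) : ℂ)⁻¹ * _ = _
  rw [intervalIntegral.integral_congr fun θ _ => hz θ, intervalIntegral.integral_const_mul,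
    intervalIntegral.integral_sub ((hi _).add (hi _)) ((hi _).add (hi _)),
    intervalIntegral.integral_add (hi _) (hi _), intervalIntegral.integral_add (hi _) (hi _)]
  have e1 := fCoeff_neg hfe ((i : ℤ) - j)
  have e2 := fCoeff_neg hfe ((i : ℤ) + j + 1)
  simp only [fCoeff_eq] at e1 e2 ⊢
  linear_combination e1 / 2 - e2 / 2

lemma fCoeff_one (n : ℤ) : fCoeff (fun _ => 1) n = if n = 0 then 1 else 0 := by
  have hpi : ((2 * Real.pi : ℝ) : ℂ) ≠ 0 := by
    exact_mod_cast (by positivity : (2 * Real.pi : ℝ) ≠ 0)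
  unfold fCoeff
  split_ifs with h
  · subst h
    simp only [Int.cast_zero, neg_zero, zero_mul, Complex.exp_zero, mul_one,
      intervalIntegral.integral_const, sub_zero, Complex.real_smul]
    exact inv_mul_cancel₀ hpi
  · have hc : -(n : ℂ) * Complex.I ≠ 0 :=
      mul_ne_zero (neg_ne_zero.mpr (Int.cast_ne_zero.mpr h)) Complex.I_ne_zero
    simp only [one_mul]
    rw [integral_exp_mul_complex hc]
    have he : Complex.exp (-(n : ℂ) * Complex.I * ((2 * Real.pi : ℝ) : ℂ)) = 1 := by
      rw [Complex.exp_eq_one_iff]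
      exact ⟨-n, by push_cast; ring⟩
    rw [he]; simp

lemma circleFunctional_chebW_mul_chebW (i j : ℕ) :
    circleFunctional (chebW ℂ i * chebW ℂ j) = if i = j then 1 else 0 := by
  have h := circleFunctional_mul_chebW_mul_chebW 1 i j
  simp only [one_mul, eval_one, fCoeff_one] at h
  rw [h, if_neg (show (i : ℤ) + j + 1 ≠ 0 by lia), sub_zero]
  simp [sub_eq_zero]

lemma phiGG_eq {k : ℕ} {a : Fin k → ℂ} (ha : ∀ i, a i ≠ 0) (θ : ℝ) :
    phiGG a θ = ((-1) ^ k * ∏ i, a i) *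
      (∏ i, (X - C (a i + (a i)⁻¹))).eval
        (Complex.exp (Complex.I * θ) + (Complex.exp (Complex.I * θ))⁻¹) := by
  have hk : ((-1 : ℂ)) ^ k = ∏ _i : Fin k, (-1 : ℂ) := by simp
  have h0 : Complex.exp (Complex.I * θ) ≠ 0 := Complex.exp_ne_zero _
  rw [phiGG, eval_prod, hk, ← Finset.prod_mul_distrib, ← Finset.prod_mul_distrib,
    ← Finset.prod_mul_distrib, neg_mul, Complex.exp_neg]
  refine Finset.prod_congr rfl fun i _ => ?_
  have := ha i
  simp only [eval_sub, eval_X, eval_C]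
  field_simp
  ring

lemma fCoeff_const_mul (c : ℂ) (f : ℝ → ℂ) (n : ℤ) :
    fCoeff (fun θ => c * f θ) n = c * fCoeff f n := by
  simp_rw [fCoeff, mul_assoc]
  rw [intervalIntegral.integral_const_mul, mul_left_comm]

lemma det_toeplitz_sub_hankel_mul_det_chebWMatrix {m k : ℕ} {a : Fin k → ℂ}
    (ha : ∀ i, a i ≠ 0) :
    (Matrix.of fun j k' : Fin m =>
        fCoeff (phiGG a) (((j : ℕ) : ℤ) - ((k' : ℕ) : ℤ)) -
          fCoeff (phiGG a) (((j : ℕ) : ℤ) + ((k' : ℕ) : ℤ) + 1)).det *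
        (chebWMatrix fun i => a i + (a i)⁻¹).det =
      (∏ i, a i ^ m) *
        (Matrix.of fun i s : Fin k => (chebW ℂ (m + s)).eval (a i + (a i)⁻¹)).det := by
  rw [← det_gram_mul_det_chebWMatrix circleFunctional circleFunctional_chebW_mul_chebW]
  rw [show phiGG a = _ from funext (phiGG_eq ha)]
  simp_rw [fCoeff_const_mul, ← mul_sub, ← circleFunctional_mul_chebW_mul_chebW]
  have h : (Matrix.of fun i j : Fin m => ((-1) ^ k * ∏ i, a i) *
      circleFunctional ((∏ l, (X - C (a l + (a l)⁻¹))) * (chebW ℂ i * chebW ℂ j))) =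
      ((-1) ^ k * ∏ i, a i) • Matrix.of fun i j : Fin m =>
        circleFunctional ((∏ l, (X - C (a l + (a l)⁻¹))) * (chebW ℂ i * chebW ℂ j)) := by
    ext i j; simp
  rw [h, Matrix.det_smul, Fintype.card_fin, mul_pow, ← pow_mul, Finset.prod_pow]
  ring

end FourierCoefficients

section Average

variable {m k : ℕ}

lemma integral_prod_det_eq_of_injective {μ : Measure (SOg (2 * m + 1))} [μ.IsHaarMeasure]
    [IsProbabilityMeasure μ] {a : Fin k → ℂ} (ha : ∀ i, a i ≠ 0)
    (hinj : Function.Injective fun i => a i + (a i)⁻¹) :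
    ∫ u : SOg (2 * m + 1),
        ∏ i, (1 - a i • toC (u : Matrix.orthogonalGroup (Fin (2 * m + 1)) ℝ)).det ∂μ =
      (∏ i, (1 - a i)) * (Matrix.of fun j k' : Fin m =>
        fCoeff (phiGG a) (((j : ℕ) : ℤ) - ((k' : ℕ) : ℤ)) -
          fCoeff (phiGG a) (((j : ℕ) : ℤ) + ((k' : ℕ) : ℤ) + 1)).det := by
  have hV : (chebWMatrix fun i => a i + (a i)⁻¹).det ≠ 0 := by
    rw [det_chebWMatrix]
    exact Matrix.det_vandermonde_ne_zero_iff.mpr hinj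
  refine mul_left_cancel₀ hV ?_
  rw [det_chebWMatrix_mul_integral_prod_det ha, Finset.prod_mul_distrib]
  linear_combination -(∏ i, (1 - a i)) *
    det_toeplitz_sub_hankel_mul_det_chebWMatrix (m := m) ha

lemma continuous_integral_prod_det {N : ℕ} (μ : Measure (SOg N)) [IsFiniteMeasure μ]
    {b : ℂ → Fin k → ℂ} (hb : Continuous b) :
    Continuous fun t => ∫ u : SOg N,
      ∏ i, (1 - b t i • toC (u : Matrix.orthogonalGroup (Fin N) ℝ)).det ∂μ := by
  have htoC : Continuous fun u : SOg N => toC (u : Matrix.orthogonalGroup (Fin N) ℝ) :=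
    (continuous_soMat (N := N)).matrix_map Complex.continuous_ofReal
  have h := continuous_parametric_integral_of_continuous (μ := μ) (f := fun t (u : SOg N) =>
    ∏ i, (1 - b t i • toC (u : Matrix.orthogonalGroup (Fin N) ℝ)).det)
    (continuous_finsetProd _ fun i _ => Continuous.matrix_det (continuous_const.sub
      ((((continuous_apply i).comp hb).comp continuous_fst).smul
        (htoC.comp continuous_snd)))) isCompact_univ
  simpa using h

lemma continuous_fCoeff_phiGG {b : ℂ → Fin k → ℂ} (hb : Continuous b) (n : ℤ) :
    Continuous fun t => fCoeff (phiGG (b t)) n := by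
  have hbi : ∀ i, Continuous fun t => b t i := fun i => (continuous_apply i).comp hb
  refine Continuous.mul continuous_const
    (intervalIntegral.continuous_parametric_intervalIntegral_of_continuous' ?_ _ _)
  unfold phiGG Function.uncurry
  dsimp only
  fun_prop

lemma dense_setOf_injective_add_inv (a : Fin k → ℂ) :
    Dense {t : ℂ | (∀ i : Fin k, a i + ((i : ℕ) + 1 : ℂ) * t ≠ 0) ∧
      Function.Injective fun i : Fin k =>
        (a i + ((i : ℕ) + 1 : ℂ) * t) + (a i + ((i : ℕ) + 1 : ℂ) * t)⁻¹} := by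
  set B : Fin k → ℂ[X] := fun i => C (a i) + C ((i : ℕ) + 1 : ℂ) * X with hB
  have hBeval : ∀ i t, (B i).eval t = a i + ((i : ℕ) + 1 : ℂ) * t := fun i t => by simp [hB]
  have hi0 : ∀ i : Fin k, ((i : ℕ) + 1 : ℂ) ≠ 0 := fun i => Nat.cast_add_one_ne_zero _
  have hB1 : ∀ i, (B i).coeff 1 = (i : ℕ) + 1 := fun i => by simp [hB]
  have h0 : ∀ i, B i ≠ 0 := fun i h => hi0 i (by rw [← hB1, h, coeff_zero])
  have h1 : ∀ i l, l ≠ i → B i - B l ≠ 0 := fun i l hil h => by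
    have := congrArg (fun p => p.coeff 1) h
    simp only [coeff_sub, hB1, coeff_zero, add_sub_add_right_eq_sub, sub_eq_zero,
      Nat.cast_inj] at this
    exact hil (Fin.ext this.symm)
  have h2 : ∀ i l, 1 - B i * B l ≠ 0 := fun i l h => by
    have hd : ∀ i, (B i).natDegree = 1 := fun i => by
      simp only [hB, add_comm (C (a i))]
      exact natDegree_linear (hi0 i)
    have := congrArg natDegree (sub_eq_zero.mp h)
    rw [natDegree_mul (h0 i) (h0 l), hd, hd, natDegree_one] at this
    lia
  set Q : ℂ[X] := (∏ i, B i) *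
    ∏ i, ∏ l ∈ Finset.univ.erase i, ((B i - B l) * (1 - B i * B l)) with hQ
  have hQ0 : Q ≠ 0 := mul_ne_zero (Finset.prod_ne_zero_iff.mpr fun i _ => h0 i)
    (Finset.prod_ne_zero_iff.mpr fun i _ => Finset.prod_ne_zero_iff.mpr fun l hl =>
      mul_ne_zero (h1 i l (Finset.ne_of_mem_erase hl)) (h2 i l))
  have hfin : {t | Q.IsRoot t}.Countable := (finite_setOfPred_isRoot hQ0).countable
  refine (hfin.dense_compl ℂ).mono fun t ht => ?_
  have ht' : Q.eval t ≠ 0 := ht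
  rw [hQ, eval_mul, eval_prod, eval_prod, mul_ne_zero_iff, Finset.prod_ne_zero_iff,
    Finset.prod_ne_zero_iff] at ht'
  have hne : ∀ i, a i + ((i : ℕ) + 1 : ℂ) * t ≠ 0 := fun i => by
    rw [← hBeval]; exact ht'.1 i (Finset.mem_univ i)
  refine ⟨hne, fun i l hil => ?_⟩
  by_contra hne'
  have h3 := ht'.2 i (Finset.mem_univ i)
  rw [eval_prod, Finset.prod_ne_zero_iff] at h3
  refine h3 l (Finset.mem_erase.mpr ⟨Ne.symm hne', Finset.mem_univ l⟩) ?_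
  simp only [eval_mul, eval_sub, eval_one, hBeval]
  have hi := hne i
  have hl := hne l
  dsimp only at hil
  generalize a i + ((i : ℕ) + 1 : ℂ) * t = x at *
  generalize a l + ((l : ℕ) + 1 : ℂ) * t = y at *
  field_simp at hil
  linear_combination -hil

lemma integral_prod_det_eq {μ : Measure (SOg (2 * m + 1))} [μ.IsHaarMeasure]
    [IsProbabilityMeasure μ] (a : Fin k → ℂ) :
    ∫ u : SOg (2 * m + 1),
        ∏ i, (1 - a i • toC (u : Matrix.orthogonalGroup (Fin (2 * m + 1)) ℝ)).det ∂μ =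
      (∏ i, (1 - a i)) * (Matrix.of fun j k' : Fin m =>
        fCoeff (phiGG a) (((j : ℕ) : ℤ) - ((k' : ℕ) : ℤ)) -
          fCoeff (phiGG a) (((j : ℕ) : ℤ) + ((k' : ℕ) : ℤ) + 1)).det := by
  set b : ℂ → Fin k → ℂ := fun t i => a i + ((i : ℕ) + 1 : ℂ) * t with hbdef
  have hb : Continuous b := by fun_prop
  have hR : Continuous fun t => (∏ i, (1 - b t i)) * (Matrix.of fun j k' : Fin m =>
        fCoeff (phiGG (b t)) (((j : ℕ) : ℤ) - ((k' : ℕ) : ℤ)) -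
          fCoeff (phiGG (b t)) (((j : ℕ) : ℤ) + ((k' : ℕ) : ℤ) + 1)).det :=
    (continuous_finsetProd _ fun i _ => continuous_const.sub ((continuous_apply i).comp hb)).mul
      (Continuous.matrix_det (continuous_matrix fun i j =>
        (continuous_fCoeff_phiGG hb _).sub (continuous_fCoeff_phiGG hb _)))
  have h := congrFun (Continuous.ext_on (dense_setOf_injective_add_inv a)
    (continuous_integral_prod_det μ hb) hR
    fun t ht => integral_prod_det_eq_of_injective ht.1 ht.2) 0
  simpa [hbdef] using h

end Average

end

/-- The Haar average over `O⁺(N+1) = SO(N+1)`, `N = 2m`, of `∏_i det(1 - a_i u)` equals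
`g(1) · det (φ_{j-k} - φ_{j+k+1})_{0 ≤ j,k < m}`. -/
theorem oplus_average_eq_toeplitz_minus_hankel (m : ℕ) (hm : 1 ≤ m) (N : ℕ) (hN : N = 2 * m)
    (k : ℕ) (a : Fin k → ℂ)
    (μ : Measure (SOg (N + 1)))
    [IsProbabilityMeasure μ] [μ.IsHaarMeasure] :
    (∫ u : SOg (N + 1),
        ∏ i : Fin k,
          ((1 : Matrix (Fin (N + 1)) (Fin (N + 1)) ℂ) -
            a i • toC (u : Matrix.orthogonalGroup (Fin (N + 1)) ℝ)).det ∂μ)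
      = (∏ i : Fin k, (1 - a i)) *
        (Matrix.of fun j k' : Fin m =>
          fCoeff (phiGG a) (((j : ℕ) : ℤ) - ((k' : ℕ) : ℤ)) -
            fCoeff (phiGG a) (((j : ℕ) : ℤ) + ((k' : ℕ) : ℤ) + 1)).det := by
  subst hN
  exact integral_prod_det_eq a
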